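/- Let p be a prime and let B be a quaternion algebra over ℚ ramified exactly at p and ∞. If O and O' are maximal orders of B such that a_{O'^T}(n) ≥ a_{O^T}(n) for every integer n ≥ 1 (i.e. the Gross lattice O'^T optimally dominates O^T), then O and O' are of the same type, i.e. there exists a nonzero c ∈ B with O' = c·O·c⁻¹. -/

import Mathlib

open Quaternion Polynomial

variable {c₁ c₂ : ℚ}

/-- The reduced norm on a quaternion algebra over ℚ. -/
noncomputable def Nr (x : ℍ[ℚ, c₁, c₂]) : ℚ := (x * star x).re

/-- The reduced trace on a quaternion algebra over ℚ. -/
noncomputable def Trd (x : ℍ[ℚ, c₁, c₂]) : ℚ := (x + star x).re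

/-- An order of the quaternion algebra: a subring (ℤ-subalgebra) which is finitely
generated as a ℤ-module and contains a ℚ-basis, i.e. spans the algebra over ℚ. -/
def IsOrder (O : Subalgebra ℤ ℍ[ℚ, c₁, c₂]) : Prop :=
  (Subalgebra.toSubmodule O).FG ∧ Submodule.span ℚ (O : Set ℍ[ℚ, c₁, c₂]) = ⊤

/-- A maximal order: an order not properly contained in another order. -/
def IsMaximalOrder (O : Subalgebra ℤ ℍ[ℚ, c₁, c₂]) : Prop :=
  IsOrder O ∧ ∀ O' : Subalgebra ℤ ℍ[ℚ, c₁, c₂], IsOrder O' → O ≤ O' → O' = O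

/-- The ℤ-linear map `x ↦ 2x - Tr(x)·1 = x - star x`. -/
noncomputable def grossMap : ℍ[ℚ, c₁, c₂] →ₗ[ℤ] ℍ[ℚ, c₁, c₂] where
  toFun x := 2 • x - (x + star x)
  map_add' x y := by
    simp only [star_add, smul_add]
    abel
  map_smul' k x := by
    simp only [QuaternionAlgebra.star_smul, RingHom.id_apply, smul_add, smul_sub, smul_comm k]

/-- The Gross lattice `O^T = {2x - Tr(x)·1 : x ∈ O}` of an order. -/
noncomputable def GrossLattice (O : Subalgebra ℤ ℍ[ℚ, c₁, c₂]) :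
    Submodule ℤ ℍ[ℚ, c₁, c₂] :=
  Submodule.map grossMap (Subalgebra.toSubmodule O)

/-- `h` is primitive in the ℤ-module `L` if `h ≠ k • h'` for every integer `k ≥ 2`
and every `h' ∈ L`. -/
def IsPrimitiveIn (L : Submodule ℤ ℍ[ℚ, c₁, c₂]) (h : ℍ[ℚ, c₁, c₂]) : Prop :=
  ∀ k : ℤ, 2 ≤ k → ∀ h' ∈ L, h ≠ k • h'

/-- `r_{O^T}(n)`: the number of elements of the Gross lattice of reduced norm `n`. -/
noncomputable def rCount (O : Subalgebra ℤ ℍ[ℚ, c₁, c₂]) (n : ℕ) : ℕ :=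
  Nat.card {h : ℍ[ℚ, c₁, c₂] // h ∈ GrossLattice O ∧ Nr h = n}

/-- `a_{O^T}(n)`: the number of primitive elements of the Gross lattice of reduced norm `n`. -/
noncomputable def aCount (O : Subalgebra ℤ ℍ[ℚ, c₁, c₂]) (n : ℕ) : ℕ :=
  Nat.card {h : ℍ[ℚ, c₁, c₂] //
    h ∈ GrossLattice O ∧ Nr h = n ∧ IsPrimitiveIn (GrossLattice O) h}

/-- `B` is ramified exactly at `p` and `∞`: the real and `p`-adic completions are
division rings, while the `ℓ`-adic completion is not a division ring for `ℓ ≠ p`. -/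
def RamifiedExactlyAt (p : ℕ) [Fact p.Prime] (c₁ c₂ : ℚ) : Prop :=
  (∀ x : ℍ[ℝ, (c₁ : ℝ), (c₂ : ℝ)], x ≠ 0 → ∃ y, x * y = 1 ∧ y * x = 1) ∧
  (∀ x : ℍ[ℚ_[p], (c₁ : ℚ_[p]), (c₂ : ℚ_[p])], x ≠ 0 → ∃ y, x * y = 1 ∧ y * x = 1) ∧
  ∀ (ℓ : ℕ) [Fact ℓ.Prime], ℓ ≠ p →
    ¬ (∀ x : ℍ[ℚ_[ℓ], (c₁ : ℚ_[ℓ]), (c₂ : ℚ_[ℓ])], x ≠ 0 → ∃ y, x * y = 1 ∧ y * x = 1)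

/-- The bilinear form attached to the reduced norm. -/
noncomputable def ip (x y : ℍ[ℚ, c₁, c₂]) : ℚ := (x * star y).re

/-- The cross product `(xy - yx)/2`. -/
noncomputable def crs (x y : ℍ[ℚ, c₁, c₂]) : ℍ[ℚ, c₁, c₂] := (1 / 2 : ℚ) • (x * y - y * x)

/-- The triple product of three quaternions. -/
noncomputable def tri (x y z : ℍ[ℚ, c₁, c₂]) : ℚ := ip (crs x y) z

lemma ip_eq (x y : ℍ[ℚ, c₁, c₂]) : ip x y =
    x.re * y.re - c₁ * x.imI * y.imI - c₂ * x.imJ * y.imJ + c₁ * c₂ * x.imK * y.imK := by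
  simp [ip]; ring

lemma Nr_eq (x : ℍ[ℚ, c₁, c₂]) : Nr x =
    x.re ^ 2 - c₁ * x.imI ^ 2 - c₂ * x.imJ ^ 2 + c₁ * c₂ * x.imK ^ 2 := by
  simp [Nr]; ring

lemma Nr_eq_ip (x : ℍ[ℚ, c₁, c₂]) : Nr x = ip x x := rfl

lemma Trd_eq (x : ℍ[ℚ, c₁, c₂]) : Trd x = 2 * x.re := by simp [Trd]; ring

lemma crs_re (x y : ℍ[ℚ, c₁, c₂]) : (crs x y).re = 0 := by
  simp [crs]; ring

lemma crs_imI (x y : ℍ[ℚ, c₁, c₂]) :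
    (crs x y).imI = c₂ * (x.imK * y.imJ - x.imJ * y.imK) := by
  simp [crs]; ring

lemma crs_imJ (x y : ℍ[ℚ, c₁, c₂]) :
    (crs x y).imJ = c₁ * (x.imI * y.imK - x.imK * y.imI) := by
  simp [crs]; ring

lemma crs_imK (x y : ℍ[ℚ, c₁, c₂]) :
    (crs x y).imK = x.imI * y.imJ - x.imJ * y.imI := by
  simp [crs]; ring

lemma tri_eq (x y z : ℍ[ℚ, c₁, c₂]) : tri x y z = c₁ * c₂ *
    ((x.imJ * y.imK - x.imK * y.imJ) * z.imI + (x.imK * y.imI - x.imI * y.imK) * z.imJ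
      + (x.imI * y.imJ - x.imJ * y.imI) * z.imK) := by
  simp only [tri, ip_eq, crs_re, crs_imI, crs_imJ, crs_imK]; ring

lemma ip_comm (x y : ℍ[ℚ, c₁, c₂]) : ip x y = ip y x := by
  simp only [ip_eq]; ring

lemma ip_sub_left (x y z : ℍ[ℚ, c₁, c₂]) : ip (x - y) z = ip x z - ip y z := by
  simp [ip_eq]; ring

lemma ip_smul_left (q : ℚ) (x z : ℍ[ℚ, c₁, c₂]) : ip (q • x) z = q * ip x z := by
  simp [ip_eq]; ring

lemma ip_add_right (x y z : ℍ[ℚ, c₁, c₂]) : ip x (y + z) = ip x y + ip x z := by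
  simp [ip_eq]; ring

lemma ip_sub_right (x y z : ℍ[ℚ, c₁, c₂]) : ip x (y - z) = ip x y - ip x z := by
  simp [ip_eq]; ring

lemma ip_smul_right (q : ℚ) (x z : ℍ[ℚ, c₁, c₂]) : ip x (q • z) = q * ip x z := by
  simp [ip_eq]; ring

/-- The square of the triple product is the Gram determinant. -/
lemma tri_sq {x y z : ℍ[ℚ, c₁, c₂]} (hx : x.re = 0) (hy : y.re = 0) (hz : z.re = 0) :
    tri x y z ^ 2 = ip x x * ip y y * ip z z + 2 * ip x y * ip x z * ip y z
      - ip x x * ip y z ^ 2 - ip y y * ip x z ^ 2 - ip z z * ip x y ^ 2 := by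
  simp only [tri_eq, ip_eq, hx, hy, hz]; ring

lemma Nr_crs {x y : ℍ[ℚ, c₁, c₂]} (hx : x.re = 0) (hy : y.re = 0) :
    Nr (crs x y) = ip x x * ip y y - ip x y ^ 2 := by
  simp only [Nr_eq, ip_eq, crs_re, crs_imI, crs_imJ, crs_imK, hx, hy]; ring

lemma Nr_mul (x y : ℍ[ℚ, c₁, c₂]) : Nr (x * y) = Nr x * Nr y := by
  simp [Nr_eq]; ring

lemma Nr_pow (x : ℍ[ℚ, c₁, c₂]) (n : ℕ) : Nr (x ^ n) = Nr x ^ n := by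
  induction n with
  | zero => simp [Nr_eq]
  | succ n ih => rw [pow_succ, Nr_mul, ih, pow_succ]

lemma mul_star_self' (x : ℍ[ℚ, c₁, c₂]) : x * star x = (Nr x : ℍ[ℚ, c₁, c₂]) :=
  QuaternionAlgebra.mul_star_eq_coe x

lemma star_mul_self' (x : ℍ[ℚ, c₁, c₂]) : star x * x = (Nr x : ℍ[ℚ, c₁, c₂]) := by
  rw [QuaternionAlgebra.star_mul_eq_coe]
  congr 1
  simp [Nr_eq]; ring

/-- If the real completion is a division ring then both structure constants are negative. -/
lemma neg_of_division
    (h : ∀ x : ℍ[ℝ, (c₁ : ℝ), (c₂ : ℝ)], x ≠ 0 → ∃ y, x * y = 1 ∧ y * x = 1) :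
    c₁ < 0 ∧ c₂ < 0 := by
  constructor
  · by_contra hn
    have h1 : (0 : ℝ) ≤ c₁ := by exact_mod_cast not_lt.1 hn
    set s := Real.sqrt c₁
    have hs : s * s = c₁ := Real.mul_self_sqrt h1
    let x : ℍ[ℝ, (c₁ : ℝ), (c₂ : ℝ)] := ⟨s, 1, 0, 0⟩
    let z : ℍ[ℝ, (c₁ : ℝ), (c₂ : ℝ)] := ⟨s, -1, 0, 0⟩
    obtain ⟨y, -, hy⟩ := h x (fun e => by simpa [x] using congrArg QuaternionAlgebra.imI e)
    have hxz : x * z = 0 := by ext <;> (simp [x, z]; try linarith)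
    have : z = 0 := by
      rw [← one_mul z, ← hy, mul_assoc, hxz, mul_zero]
    simpa [z] using congrArg QuaternionAlgebra.imI this
  · by_contra hn
    have h1 : (0 : ℝ) ≤ c₂ := by exact_mod_cast not_lt.1 hn
    set s := Real.sqrt c₂
    have hs : s * s = c₂ := Real.mul_self_sqrt h1
    let x : ℍ[ℝ, (c₁ : ℝ), (c₂ : ℝ)] := ⟨s, 0, 1, 0⟩
    let z : ℍ[ℝ, (c₁ : ℝ), (c₂ : ℝ)] := ⟨s, 0, -1, 0⟩
    obtain ⟨y, -, hy⟩ := h x (fun e => by simpa [x] using congrArg QuaternionAlgebra.imJ e)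
    have hxz : x * z = 0 := by ext <;> (simp [x, z]; try linarith)
    have : z = 0 := by
      rw [← one_mul z, ← hy, mul_assoc, hxz, mul_zero]
    simpa [z] using congrArg QuaternionAlgebra.imJ this

lemma Nr_nonneg (h₁ : c₁ < 0) (h₂ : c₂ < 0) (x : ℍ[ℚ, c₁, c₂]) : 0 ≤ Nr x := by
  rw [Nr_eq]
  have := mul_nonneg (neg_nonneg.2 h₁.le) (sq_nonneg x.imI)
  have := mul_nonneg (neg_nonneg.2 h₂.le) (sq_nonneg x.imJ)
  have := mul_nonneg (mul_pos_of_neg_of_neg h₁ h₂).le (sq_nonneg x.imK)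
  nlinarith [sq_nonneg x.re]

lemma Nr_pos (h₁ : c₁ < 0) (h₂ : c₂ < 0) {x : ℍ[ℚ, c₁, c₂]} (hx : x ≠ 0) : 0 < Nr x := by
  have h1 := mul_nonneg (neg_nonneg.2 h₁.le) (sq_nonneg x.imI)
  have h2 := mul_nonneg (neg_nonneg.2 h₂.le) (sq_nonneg x.imJ)
  have h3 := mul_nonneg (mul_pos_of_neg_of_neg h₁ h₂).le (sq_nonneg x.imK)
  have h0 := sq_nonneg x.re
  refine lt_of_le_of_ne (Nr_nonneg h₁ h₂ x) fun e => hx ?_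
  rw [Nr_eq] at e
  have e0 : x.re ^ 2 = 0 := by linarith
  have e1 : -c₁ * x.imI ^ 2 = 0 := by linarith
  have e2 : -c₂ * x.imJ ^ 2 = 0 := by linarith
  have e3 : c₁ * c₂ * x.imK ^ 2 = 0 := by linarith
  have f1 := h₁.ne
  have f2 := h₂.ne
  simp [f1, f2] at e0 e1 e2 e3
  ext <;> simp [e0, e1, e2, e3]

lemma Nr_eq_zero (h₁ : c₁ < 0) (h₂ : c₂ < 0) {x : ℍ[ℚ, c₁, c₂]} : Nr x = 0 ↔ x = 0 := by
  refine ⟨fun h => by_contra fun hx => (Nr_pos h₁ h₂ hx).ne' h, fun h => by simp [h, Nr_eq]⟩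

section

lemma two_re : (2 : ℍ[ℚ, c₁, c₂]).re = 2 := rfl

lemma two_imI : (2 : ℍ[ℚ, c₁, c₂]).imI = 0 := rfl

lemma two_imJ : (2 : ℍ[ℚ, c₁, c₂]).imJ = 0 := rfl

lemma two_imK : (2 : ℍ[ℚ, c₁, c₂]).imK = 0 := rfl

/-- The subgroup of rationals whose product with `N` is an integer. -/
def denomGroup (N : ℕ) : AddSubgroup ℚ :=
  (AddSubgroup.map (AddMonoidHom.mulLeft ((N : ℚ)⁻¹)) (Int.castAddHom ℚ).range)

lemma mem_denomGroup {N : ℕ} (hN : N ≠ 0) {q : ℚ} :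
    q ∈ denomGroup N ↔ ∃ m : ℤ, (N : ℚ) * q = m := by
  have hN' : (N : ℚ) ≠ 0 := by exact_mod_cast hN
  simp only [denomGroup, AddSubgroup.mem_map, AddMonoidHom.mem_range, AddMonoidHom.coe_mulLeft,
    Int.coe_castAddHom, exists_exists_eq_and]
  constructor
  · rintro ⟨m, rfl⟩
    exact ⟨m, by field_simp⟩
  · rintro ⟨m, hm⟩
    exact ⟨m, by rw [← hm]; field_simp⟩

lemma mem_denomGroup_of_den_dvd {N : ℕ} (hN : N ≠ 0) {q : ℚ} (h : q.den ∣ N) :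
    q ∈ denomGroup N := by
  obtain ⟨k, rfl⟩ := h
  refine (mem_denomGroup hN).2 ⟨k * q.num, ?_⟩
  push_cast
  rw [← Rat.den_mul_eq_num]; ring

/-- The coordinates of the elements of a finitely generated lattice have a common denominator. -/
lemma exists_common_denom {L : Submodule ℤ ℍ[ℚ, c₁, c₂]} (hL : L.FG) :
    ∃ N : ℕ, N ≠ 0 ∧ ∀ x ∈ L, x.re ∈ denomGroup N ∧ x.imI ∈ denomGroup N ∧
      x.imJ ∈ denomGroup N ∧ x.imK ∈ denomGroup N := by
  obtain ⟨S, rfl⟩ := hL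
  let N := ∏ s ∈ S, s.re.den * s.imI.den * s.imJ.den * s.imK.den
  have hN : N ≠ 0 := Finset.prod_ne_zero_iff.2 fun s _ => by simp
  refine ⟨N, hN, fun x hx => ?_⟩
  induction hx using Submodule.span_induction with
  | mem s hs =>
    have hd : s.re.den * s.imI.den * s.imJ.den * s.imK.den ∣ N :=
      Finset.dvd_prod_of_mem (fun s : ℍ[ℚ, c₁, c₂] =>
        s.re.den * s.imI.den * s.imJ.den * s.imK.den) hs
    exact ⟨mem_denomGroup_of_den_dvd hN
        (((Dvd.intro _ rfl).mul_right _ |>.mul_right _).trans hd),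
      mem_denomGroup_of_den_dvd hN (((Dvd.intro_left _ rfl).mul_right _ |>.mul_right _).trans hd),
      mem_denomGroup_of_den_dvd hN (((Dvd.intro_left _ rfl).mul_right _).trans hd),
      mem_denomGroup_of_den_dvd hN ((Dvd.intro_left _ rfl).trans hd)⟩
  | zero => simp [zero_mem]
  | add x y _ _ hx hy =>
    exact ⟨add_mem hx.1 hy.1, add_mem hx.2.1 hy.2.1, add_mem hx.2.2.1 hy.2.2.1,
      add_mem hx.2.2.2 hy.2.2.2⟩
  | smul n x _ hx =>
    exact ⟨zsmul_mem hx.1 n, zsmul_mem hx.2.1 n, zsmul_mem hx.2.2.1 n, zsmul_mem hx.2.2.2 n⟩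

/-- A rational number all of whose powers have a common denominator is an integer. -/
lemma exists_int_of_pow_denom {q : ℚ} {N : ℕ} (hN : N ≠ 0)
    (h : ∀ n : ℕ, ∃ m : ℤ, (N : ℚ) * q ^ n = m) : ∃ m : ℤ, q = m := by
  have hd : q.den ^ N ∣ N := by
    obtain ⟨m, hm⟩ := h N
    have h1 : (N : ℤ) * q.num ^ N = m * (q.den : ℤ) ^ N := by
      have hq : (q.den : ℚ) ≠ 0 := by exact_mod_cast q.den_nz
      have : (N : ℚ) * (q.num : ℚ) ^ N = m * (q.den : ℚ) ^ N := by
        rw [← hm, ← Rat.mul_den_eq_num, mul_pow]; ring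
      exact_mod_cast this
    have hc : IsCoprime ((q.den : ℤ) ^ N) (q.num ^ N) := by
      apply IsCoprime.pow
      rw [Int.isCoprime_iff_gcd_eq_one, Int.gcd_comm]
      simpa [Int.gcd] using q.reduced
    have : (q.den : ℤ) ^ N ∣ N := hc.dvd_of_dvd_mul_right ⟨m, by rw [h1]; ring⟩
    exact_mod_cast this
  have hden : q.den = 1 := by
    by_contra hne
    have h2 : 2 ≤ q.den := by have := q.den_pos; omega
    have := Nat.le_of_dvd (Nat.pos_of_ne_zero hN) hd
    have := Nat.pow_le_pow_left h2 N
    have := Nat.lt_two_pow_self (n := N)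
    omega
  exact ⟨q.num, by rw [← Rat.mul_den_eq_num, hden]; simp⟩

variable {O : Subalgebra ℤ ℍ[ℚ, c₁, c₂]}

/-- Reduced norms of elements of an order are integers. -/
lemma IsOrder.exists_Nr (hO : IsOrder O) {x : ℍ[ℚ, c₁, c₂]} (hx : x ∈ O) :
    ∃ n : ℤ, Nr x = n := by
  obtain ⟨N, hN, h⟩ := exists_common_denom hO.1
  refine exists_int_of_pow_denom (N := N ^ 2 * (c₁.den * c₂.den))
    (mul_ne_zero (pow_ne_zero _ hN) (by simp)) fun n => ?_
  obtain ⟨hr, hi, hj, hk⟩ := h (x ^ n) (pow_mem hx n)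
  rw [mem_denomGroup hN] at hr hi hj hk
  obtain ⟨r, hr⟩ := hr
  obtain ⟨i, hi⟩ := hi
  obtain ⟨j, hj⟩ := hj
  obtain ⟨k, hk⟩ := hk
  refine ⟨c₁.den * c₂.den * r ^ 2 - c₁.num * c₂.den * i ^ 2 - c₁.den * c₂.num * j ^ 2
    + c₁.num * c₂.num * k ^ 2, ?_⟩
  rw [← Nr_pow, Nr_eq]
  push_cast
  rw [← hr, ← hi, ← hj, ← hk, ← Rat.den_mul_eq_num c₁, ← Rat.den_mul_eq_num c₂]
  ring

lemma Nr_add_one (x : ℍ[ℚ, c₁, c₂]) : Nr (x + 1) = Nr x + Trd x + 1 := by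
  simp [Nr_eq, Trd_eq]; ring

/-- Reduced traces of elements of an order are integers. -/
lemma IsOrder.exists_Trd (hO : IsOrder O) {x : ℍ[ℚ, c₁, c₂]} (hx : x ∈ O) :
    ∃ n : ℤ, Trd x = n := by
  obtain ⟨m, hm⟩ := hO.exists_Nr hx
  obtain ⟨n, hn⟩ := hO.exists_Nr (add_mem hx (one_mem O))
  refine ⟨n - m - 1, ?_⟩
  rw [Nr_add_one] at hn
  push_cast
  linarith

lemma mem_GrossLattice {h : ℍ[ℚ, c₁, c₂]} :
    h ∈ GrossLattice O ↔ ∃ x ∈ O, x - star x = h := by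
  simp only [GrossLattice, Submodule.mem_map, Subalgebra.mem_toSubmodule]
  refine exists_congr fun x => and_congr_right fun _ => ?_
  have : grossMap x = x - star x := by
    change 2 • x - (x + star x) = _
    rw [two_smul]; abel
  rw [this]

lemma re_eq_zero_of_mem_GrossLattice {h : ℍ[ℚ, c₁, c₂]} (hh : h ∈ GrossLattice O) :
    h.re = 0 := by
  obtain ⟨x, -, rfl⟩ := mem_GrossLattice.1 hh
  simp

lemma half_add_mem_iff (hO : IsOrder O) {h : ℍ[ℚ, c₁, c₂]} (hh : h ∈ GrossLattice O)
    {n : ℤ} (hn : Nr h = n) (t : ℤ) :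
    (1 / 2 : ℚ) • (h + ((t : ℚ) : ℍ[ℚ, c₁, c₂])) ∈ O ↔ 2 ∣ t - n := by
  obtain ⟨x, hx, rfl⟩ := mem_GrossLattice.1 hh
  obtain ⟨s, hs⟩ := hO.exists_Trd hx
  obtain ⟨m, hm⟩ := hO.exists_Nr hx
  have hnm : n = 4 * m - s ^ 2 := by
    have : (n : ℚ) = 4 * m - s ^ 2 := by
      rw [← hn, ← hm, ← hs]; simp [Nr_eq, Trd_eq]; ring
    exact_mod_cast this
  have hpar : ∀ k : ℤ, 2 ∣ k ^ 2 - k := fun k => by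
    obtain ⟨m, hm⟩ := Int.even_mul_succ_self (k - 1)
    exact ⟨m, by linear_combination hm⟩
  have key : (1 / 2 : ℚ) • (x - star x + ((t : ℚ) : ℍ[ℚ, c₁, c₂])) =
      x + (((t - s : ℚ) / 2 : ℚ) : ℍ[ℚ, c₁, c₂]) := by
    have hs' : (s : ℚ) = 2 * x.re := by rw [← hs, Trd_eq]
    rw [hs']
    ext <;> simp <;> ring
  rw [key]
  have h2 : 2 ∣ t - n ↔ 2 ∣ t - s := by
    have := hpar s
    subst hnm
    constructor <;> intro h <;> omega
  rw [h2]
  constructor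
  · intro hmem
    have h3 := sub_mem hmem hx
    rw [add_sub_cancel_left] at h3
    obtain ⟨k, hk⟩ := hO.exists_Nr h3
    have h4 : (t - s) ^ 2 = 4 * k := by
      have : ((t - s : ℚ)) ^ 2 = 4 * k := by
        rw [← hk]; simp [Nr_eq]; ring
      exact_mod_cast this
    have : (2 : ℤ) ∣ (t - s) ^ 2 := ⟨2 * k, by rw [h4]; ring⟩
    exact Int.prime_two.dvd_of_dvd_pow this
  · rintro ⟨k, hk⟩
    have : ((t - s : ℚ) / 2 : ℚ) = (k : ℤ) := by
      have : ((t - s : ℤ) : ℚ) = ((2 * k : ℤ) : ℚ) := by rw [hk]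
      push_cast at this
      rw [this]; ring
    rw [this]
    exact add_mem hx (by rw [QuaternionAlgebra.coe_intCast]; exact intCast_mem O k)

lemma exists_Nr_of_mem_GrossLattice (hO : IsOrder O) {h : ℍ[ℚ, c₁, c₂]}
    (hh : h ∈ GrossLattice O) : ∃ n : ℤ, Nr h = n ∧ (n % 4 = 0 ∨ n % 4 = 3) := by
  obtain ⟨x, hx, rfl⟩ := mem_GrossLattice.1 hh
  obtain ⟨s, hs⟩ := hO.exists_Trd hx
  obtain ⟨m, hm⟩ := hO.exists_Nr hx
  refine ⟨4 * m - s ^ 2, ?_, ?_⟩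
  · push_cast
    rw [← hm, ← hs]; simp [Nr_eq, Trd_eq]; ring
  · rcases Int.even_or_odd' s with ⟨k, rfl | rfl⟩
    · left; ring_nf; omega
    · right; ring_nf; omega

/-- An element of an order is recovered from its image in the Gross lattice and its trace. -/
lemma mem_order_iff (hO : IsOrder O) {x : ℍ[ℚ, c₁, c₂]} :
    x ∈ O ↔ x - star x ∈ GrossLattice O ∧
      ∃ t n : ℤ, Trd x = t ∧ Nr (x - star x) = n ∧ 2 ∣ t - n := by
  have key : ∀ t : ℤ, Trd x = t →
      (1 / 2 : ℚ) • (x - star x + ((t : ℚ) : ℍ[ℚ, c₁, c₂])) = x := fun t ht => by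
    rw [← ht]
    ext <;> simp [Trd_eq, two_re, two_imI, two_imJ, two_imK] <;> ring
  constructor
  · intro hx
    have hg := mem_GrossLattice.2 ⟨x, hx, rfl⟩
    obtain ⟨t, ht⟩ := hO.exists_Trd hx
    obtain ⟨n, hn, -⟩ := exists_Nr_of_mem_GrossLattice hO hg
    refine ⟨hg, t, n, ht, hn, ?_⟩
    rw [← half_add_mem_iff hO hg hn, key t ht]
    exact hx
  · rintro ⟨hg, t, n, ht, hn, h2⟩
    rw [← key t ht]
    exact (half_add_mem_iff hO hg hn t).2 h2

/-- Gross lattices conjugate by a unit come from orders conjugate by the same unit. -/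
lemma order_conj_of_GrossLattice_conj {O' : Subalgebra ℤ ℍ[ℚ, c₁, c₂]} (hO : IsOrder O)
    (hO' : IsOrder O') {c d : ℍ[ℚ, c₁, c₂]} (hcd : c * d = 1)
    (h : ∀ x, x ∈ GrossLattice O ↔ c * x * d ∈ GrossLattice O') :
    (O' : Set ℍ[ℚ, c₁, c₂]) = (fun x => c * x * d) '' (O : Set ℍ[ℚ, c₁, c₂]) := by
  have hn : Nr c * Nr d = 1 := by rw [← Nr_mul, hcd]; simp [Nr_eq]
  have hc0 : Nr c ≠ 0 := left_ne_zero_of_mul_eq_one hn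
  have hN : ∀ x, Nr (c * x * d) = Nr x := fun x => by
    rw [Nr_mul, Nr_mul]; linear_combination Nr x * hn
  have hT : ∀ x, Trd (c * x * d) = Trd x := fun x => by
    have h1 : Nr (c * x * d + 1) = Nr (x + 1) := by
      rw [← hN (x + 1), mul_add, add_mul, mul_one, hcd]
    rw [Nr_add_one, Nr_add_one, hN] at h1
    linarith
  have hst : ∀ x, star x = ((Trd x : ℚ) : ℍ[ℚ, c₁, c₂]) - x := fun x => by
    ext <;> simp [Trd_eq, two_re, two_imI, two_imJ, two_imK]; ring
  have hs : ∀ x, c * x * d - star (c * x * d) = c * (x - star x) * d := fun x => by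
    rw [hst, hst x, hT]
    have : c * ((Trd x : ℚ) : ℍ[ℚ, c₁, c₂]) * d = ((Trd x : ℚ) : ℍ[ℚ, c₁, c₂]) := by
      rw [← QuaternionAlgebra.coe_commutes, mul_assoc, hcd, mul_one]
    rw [mul_sub, mul_sub, sub_mul, sub_mul, this]
  have hmem : ∀ x, x ∈ O ↔ c * x * d ∈ O' := fun x => by
    rw [mem_order_iff hO, mem_order_iff hO', hs, ← h, hT, hN]
  ext y
  simp only [Set.mem_image, SetLike.mem_coe]
  constructor
  · intro hy
    have : c * (d * y * c) * d = y := by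
      rw [← mul_assoc, ← mul_assoc, hcd, one_mul, mul_assoc, hcd, mul_one]
    exact ⟨d * y * c, (hmem _).2 (by rwa [this]), this⟩
  · rintro ⟨x, hx, rfl⟩
    exact (hmem x).1 hx

end

section

/-- The ternary quadratic form with Gram matrix `(A, R, S; R, B, T; S, T, C)`. -/
def q3 {K : Type*} [CommRing K] (A B C R S T x y z : K) : K :=
  A * x ^ 2 + B * y ^ 2 + C * z ^ 2 + 2 * R * x * y + 2 * S * x * z + 2 * T * y * z

/-- The determinant of the Gram matrix `(A, R, S; R, B, T; S, T, C)`. -/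
def det3 {K : Type*} [CommRing K] (A B C R S T : K) : K :=
  A * B * C + 2 * R * S * T - A * T ^ 2 - B * S ^ 2 - C * R ^ 2

lemma q3_eq_sum_squares {K : Type*} [Field K] {A B C R S T : K} (hA : A ≠ 0)
    (hE : A * B - R ^ 2 ≠ 0) (x y z : K) :
    q3 A B C R S T x y z = A * (x + (R / A * y + S / A * z)) ^ 2 +
      (A * B - R ^ 2) / A * (y + (A * T - R * S) / (A * B - R ^ 2) * z) ^ 2 +
      det3 A B C R S T / (A * B - R ^ 2) * z ^ 2 := by
  simp only [q3, det3]
  field_simp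
  ring

lemma exists_int_add_sq_le (q : ℚ) : ∃ n : ℤ, (n + q) ^ 2 ≤ 1 / 4 := by
  refine ⟨-round q, ?_⟩
  have h := abs_sub_round q
  rw [abs_le] at h
  push_cast
  nlinarith

/-- Any vector can be translated by the lattice of the first two basis vectors so that its
first two Gram-Schmidt coordinates are small. -/
lemma exists_q3_le {A B C R S T : ℚ} (hA : 0 < A) (hE : 0 < A * B - R ^ 2) (x y z : ℚ) :
    ∃ m n : ℤ, q3 A B C R S T (x + m) (y + n) z ≤
      A / 4 + (A * B - R ^ 2) / A / 4 + det3 A B C R S T / (A * B - R ^ 2) * z ^ 2 := by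
  obtain ⟨n, hn⟩ := exists_int_add_sq_le (y + (A * T - R * S) / (A * B - R ^ 2) * z)
  obtain ⟨m, hm⟩ := exists_int_add_sq_le (x + (R / A * (y + n) + S / A * z))
  refine ⟨m, n, ?_⟩
  rw [q3_eq_sum_squares hA.ne' hE.ne']
  have h1 := mul_le_mul_of_nonneg_left hm hA.le
  have h2 := mul_le_mul_of_nonneg_left hn (div_pos hE hA).le
  have e1 : x + m + (R / A * (y + n) + S / A * z) =
    m + (x + (R / A * (y + n) + S / A * z)) := by ring
  have e2 : y + n + (A * T - R * S) / (A * B - R ^ 2) * z =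
    n + (y + (A * T - R * S) / (A * B - R ^ 2) * z) := by ring
  rw [e1, e2]
  linarith

lemma exists_q2_le {A B R : ℚ} (hA : 0 < A) (x y : ℚ) :
    ∃ m : ℤ, q3 A B 0 R 0 0 (x + m) y 0 ≤ A / 4 + (A * B - R ^ 2) / A * y ^ 2 := by
  obtain ⟨m, hm⟩ := exists_int_add_sq_le (x + R / A * y)
  refine ⟨m, ?_⟩
  have h1 := mul_le_mul_of_nonneg_left hm hA.le
  have e : q3 A B 0 R 0 0 (x + m) y 0 = A * (m + (x + R / A * y)) ^ 2 +
      (A * B - R ^ 2) / A * y ^ 2 := by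
    simp only [q3]; field_simp; ring
  rw [e]
  linarith

lemma Nr_comb (x y z : ℍ[ℚ, c₁, c₂]) (a b c : ℚ) :
    Nr (a • x + b • y + c • z) =
      q3 (ip x x) (ip y y) (ip z z) (ip x y) (ip x z) (ip y z) a b c := by
  simp [Nr_eq, ip_eq, q3]; ring

lemma crs_comb (x y z : ℍ[ℚ, c₁, c₂]) (a b c : ℚ) :
    crs x (a • x + b • y + c • z) = b • crs x y + c • crs x z := by
  ext <;> simp [crs_re, crs_imI, crs_imJ, crs_imK] <;> ring

lemma tri_comb (x y z : ℍ[ℚ, c₁, c₂]) (a b c : ℚ) :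
    tri x y (a • x + b • y + c • z) = c * tri x y z := by
  simp [tri_eq]; ring

lemma tri_eq_neg_ip (x y z : ℍ[ℚ, c₁, c₂]) : tri x y z = - ip (crs x z) y := by
  simp only [tri_eq, ip_eq, crs_re, crs_imI, crs_imJ, crs_imK]; ring

/-- Cramer's rule for pure quaternions. -/
lemma exists_comb {x y z v : ℍ[ℚ, c₁, c₂]} (hx : x.re = 0) (hy : y.re = 0) (hz : z.re = 0)
    (hv : v.re = 0) (ht : tri x y z ≠ 0) :
    ∃ a b c : ℚ, v = a • x + b • y + c • z := by
  refine ⟨tri v y z / tri x y z, tri x v z / tri x y z, tri x y v / tri x y z, ?_⟩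
  apply smul_right_injective _ ht
  simp only [smul_add, smul_smul, mul_div_cancel₀ _ ht]
  ext <;> simp [tri_eq, hx, hy, hz, hv] <;> ring

variable {O : Subalgebra ℤ ℍ[ℚ, c₁, c₂]}

/-- A basis of the Gross lattice realising its successive minima. -/
structure MinBasis (O : Subalgebra ℤ ℍ[ℚ, c₁, c₂]) (x y z : ℍ[ℚ, c₁, c₂]) : Prop where
  memx : x ∈ GrossLattice O
  memy : y ∈ GrossLattice O
  memz : z ∈ GrossLattice O
  xne : x ≠ 0
  yne : crs x y ≠ 0
  zne : tri x y z ≠ 0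
  xmin : ∀ v ∈ GrossLattice O, v ≠ 0 → Nr x ≤ Nr v
  ymin : ∀ v ∈ GrossLattice O, crs x v ≠ 0 → Nr y ≤ Nr v
  zmin : ∀ v ∈ GrossLattice O, tri x y v ≠ 0 → Nr z ≤ Nr v

lemma exists_min_Nr (h₁ : c₁ < 0) (h₂ : c₂ < 0) (hO : IsOrder O) (P : ℍ[ℚ, c₁, c₂] → Prop)
    (hP : ∃ v ∈ GrossLattice O, P v) :
    ∃ v ∈ GrossLattice O, P v ∧ ∀ w ∈ GrossLattice O, P w → Nr v ≤ Nr w := by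
  classical
  have hn : ∀ v ∈ GrossLattice O, ∃ n : ℕ, Nr v = n := fun v hv => by
    obtain ⟨n, hn, -⟩ := exists_Nr_of_mem_GrossLattice hO hv
    have := Nr_nonneg h₁ h₂ v
    rw [hn] at this
    have h0 : 0 ≤ n := by exact_mod_cast this
    lift n to ℕ using h0
    exact ⟨n, by simpa using hn⟩
  have hex : ∃ n : ℕ, ∃ v ∈ GrossLattice O, P v ∧ Nr v = n := by
    obtain ⟨v, hv, hPv⟩ := hP
    obtain ⟨n, hn⟩ := hn v hv
    exact ⟨n, v, hv, hPv, hn⟩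
  obtain ⟨v, hv, hPv, hvn⟩ := Nat.find_spec hex
  refine ⟨v, hv, hPv, fun w hw hPw => ?_⟩
  obtain ⟨m, hm⟩ := hn w hw
  rw [hvn, hm]
  exact_mod_cast Nat.find_min' hex ⟨w, hw, hPw, hm⟩

lemma crs_star_sub (x y : ℍ[ℚ, c₁, c₂]) : crs x (y - star y) = (2 : ℚ) • crs x y := by
  ext <;> simp [crs_re, crs_imI, crs_imJ, crs_imK] <;> ring

lemma exists_minBasis (h₁ : c₁ < 0) (h₂ : c₂ < 0) (hO : IsOrder O) :
    ∃ x y z, MinBasis O x y z := by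
  have hex : ∀ x ≠ 0, x.re = 0 → ∃ v ∈ GrossLattice O, crs x v ≠ 0 := by
    intro x hx hre
    by_contra! hcon
    have hall : ∀ y : ℍ[ℚ, c₁, c₂], crs x y = 0 := fun y => by
      have hy : y ∈ Submodule.span ℚ (O : Set ℍ[ℚ, c₁, c₂]) := by rw [hO.2]; trivial
      induction hy using Submodule.span_induction with
      | mem y hy =>
        have := hcon _ (mem_GrossLattice.2 ⟨y, hy, rfl⟩)
        rw [crs_star_sub] at this
        exact (smul_eq_zero.1 this).resolve_left two_ne_zero
      | zero => simp [crs]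
      | add a b _ _ ha hb =>
        have : crs x (a + b) = crs x a + crs x b := by
          simp only [crs, mul_add, add_mul, ← smul_add]; congr 1; abel
        rw [this, ha, hb, add_zero]
      | smul q a _ ha =>
        have : crs x (q • a) = q • crs x a := by
          simp [crs, smul_sub, smul_smul, mul_comm q]
        rw [this, ha, smul_zero]
    have hI := hall ⟨0, 1, 0, 0⟩
    have hJ := hall ⟨0, 0, 1, 0⟩
    have e1 := congrArg QuaternionAlgebra.imJ hI
    have e2 := congrArg QuaternionAlgebra.imK hI
    have e3 := congrArg QuaternionAlgebra.imK hJ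
    simp [crs_imJ, crs_imK, h₁.ne] at e1 e2 e3
    exact hx (by ext <;> simp [hre, e1, e2, e3])
  have hex3 : ∀ x y : ℍ[ℚ, c₁, c₂], crs x y ≠ 0 → ∃ v ∈ GrossLattice O, tri x y v ≠ 0 := by
    intro x y hxy
    by_contra! hcon
    have hall : ∀ v : ℍ[ℚ, c₁, c₂], tri x y v = 0 := fun v => by
      have hv : v ∈ Submodule.span ℚ (O : Set ℍ[ℚ, c₁, c₂]) := by rw [hO.2]; trivial
      induction hv using Submodule.span_induction with
      | mem v hv =>
        have := hcon _ (mem_GrossLattice.2 ⟨v, hv, rfl⟩)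
        have e : tri x y (v - star v) = 2 * tri x y v := by simp [tri_eq]; ring
        linarith
      | zero => simp [tri_eq]
      | add a b _ _ ha hb => rw [tri, ip_add_right, ← tri, ← tri, ha, hb, add_zero]
      | smul q a _ ha => rw [tri, ip_smul_right, ← tri, ha, mul_zero]
    exact (Nr_pos h₁ h₂ hxy).ne' (hall (crs x y))
  obtain ⟨x, hx, hx0, hxm⟩ := exists_min_Nr h₁ h₂ hO (fun v => v ≠ 0) (by
    by_contra! hcon
    obtain ⟨v, hv, hv0⟩ := hex ⟨0, 1, 0, 0⟩ (fun e => by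
      simpa using congrArg QuaternionAlgebra.imI e) rfl
    exact hv0 (by rw [hcon v hv]; simp [crs]))
  obtain ⟨y, hy, hy0, hym⟩ := exists_min_Nr h₁ h₂ hO (fun v => crs x v ≠ 0)
    (hex x hx0 (re_eq_zero_of_mem_GrossLattice hx))
  obtain ⟨z, hz, hz0, hzm⟩ := exists_min_Nr h₁ h₂ hO (fun v => tri x y v ≠ 0) (hex3 x y hy0)
  exact ⟨x, y, z, hx, hy, hz, hx0, hy0, hz0, hxm, hym, hzm⟩

namespace MinBasis

variable {x y z : ℍ[ℚ, c₁, c₂]}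

lemma rex (h : MinBasis O x y z) : x.re = 0 := re_eq_zero_of_mem_GrossLattice h.memx

lemma rey (h : MinBasis O x y z) : y.re = 0 := re_eq_zero_of_mem_GrossLattice h.memy

lemma rez (h : MinBasis O x y z) : z.re = 0 := re_eq_zero_of_mem_GrossLattice h.memz

lemma A_pos (h₁ : c₁ < 0) (h₂ : c₂ < 0) (h : MinBasis O x y z) : 0 < ip x x :=
  Nr_pos h₁ h₂ h.xne

lemma E_pos (h₁ : c₁ < 0) (h₂ : c₂ < 0) (h : MinBasis O x y z) :
    0 < ip x x * ip y y - ip x y ^ 2 := by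
  rw [← Nr_crs h.rex h.rey]; exact Nr_pos h₁ h₂ h.yne

lemma det_eq (h : MinBasis O x y z) :
    det3 (ip x x) (ip y y) (ip z z) (ip x y) (ip x z) (ip y z) = tri x y z ^ 2 := by
  rw [tri_sq h.rex h.rey h.rez, det3]

lemma det_pos (h : MinBasis O x y z) :
    0 < det3 (ip x x) (ip y y) (ip z z) (ip x y) (ip x z) (ip y z) := by
  have := h.zne
  rw [h.det_eq]; positivity

lemma A_le_B (h : MinBasis O x y z) : ip x x ≤ ip y y :=
  h.xmin y h.memy fun e => h.yne (by simp [e, crs])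

lemma crs_xz_ne (h : MinBasis O x y z) : crs x z ≠ 0 := fun e => h.zne (by
  rw [tri_eq_neg_ip, e]; simp [ip])

lemma B_le_C (h : MinBasis O x y z) : ip y y ≤ ip z z := h.ymin z h.memz h.crs_xz_ne

lemma comb_mem (h : MinBasis O x y z) (a b c : ℤ) :
    (a : ℚ) • x + (b : ℚ) • y + (c : ℚ) • z ∈ GrossLattice O := by
  simp only [Int.cast_smul_eq_zsmul]
  exact add_mem (add_mem (zsmul_mem h.memx a) (zsmul_mem h.memy b)) (zsmul_mem h.memz c)

lemma R_le (h : MinBasis O x y z) : 2 * |ip x y| ≤ ip x x := by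
  have key : ∀ e : ℤ, e ^ 2 = 1 → 0 ≤ ip x x + 2 * e * ip x y := fun e he => by
    have he' : (e : ℚ) ^ 2 = 1 := by exact_mod_cast he
    have h1 := h.ymin _ (h.comb_mem e 1 0) (by
      rw [crs_comb]; simpa using h.yne)
    rw [Nr_comb, Nr_eq_ip, q3] at h1
    push_cast at h1
    rw [he'] at h1
    linarith
  have h1 := key 1 rfl
  have h2 := key (-1) rfl
  push_cast at h1 h2
  rcases abs_cases (ip x y) with h3 | h3 <;> linarith

lemma S_le (h : MinBasis O x y z) : 2 * |ip x z| ≤ ip x x := by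
  have key : ∀ e : ℤ, e ^ 2 = 1 → 0 ≤ ip x x + 2 * e * ip x z := fun e he => by
    have he' : (e : ℚ) ^ 2 = 1 := by exact_mod_cast he
    have h1 := h.zmin _ (h.comb_mem e 0 1) (by
      rw [tri_comb]; simpa using h.zne)
    rw [Nr_comb, Nr_eq_ip, q3] at h1
    push_cast at h1
    rw [he'] at h1
    linarith
  have h1 := key 1 rfl
  have h2 := key (-1) rfl
  push_cast at h1 h2
  rcases abs_cases (ip x z) with h3 | h3 <;> linarith

lemma T_le (h : MinBasis O x y z) : 2 * |ip y z| ≤ ip y y := by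
  have key : ∀ e : ℤ, e ^ 2 = 1 → 0 ≤ ip y y + 2 * e * ip y z := fun e he => by
    have he' : (e : ℚ) ^ 2 = 1 := by exact_mod_cast he
    have h1 := h.zmin _ (h.comb_mem 0 e 1) (by
      rw [tri_comb]; simpa using h.zne)
    rw [Nr_comb, Nr_eq_ip, q3] at h1
    push_cast at h1
    rw [he'] at h1
    linarith
  have h1 := key 1 rfl
  have h2 := key (-1) rfl
  push_cast at h1 h2
  rcases abs_cases (ip y z) with h3 | h3 <;> linarith

lemma E_div_le (h₁ : c₁ < 0) (h₂ : c₂ < 0) (h : MinBasis O x y z) :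
    (ip x x * ip y y - ip x y ^ 2) / ip x x ≤ ip y y := by
  rw [div_le_iff₀ (h.A_pos h₁ h₂)]
  nlinarith [sq_nonneg (ip x y)]

lemma C_le (h₁ : c₁ < 0) (h₂ : c₂ < 0) (h : MinBasis O x y z) :
    ip z z ≤ ip x x / 4 + ip y y / 4 +
      det3 (ip x x) (ip y y) (ip z z) (ip x y) (ip x z) (ip y z) /
        (ip x x * ip y y - ip x y ^ 2) := by
  obtain ⟨m, n, hmn⟩ := exists_q3_le (h.A_pos h₁ h₂) (h.E_pos h₁ h₂)
    (C := ip z z) (S := ip x z) (T := ip y z) 0 0 1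
  have h1 := h.zmin _ (h.comb_mem m n 1) (by rw [tri_comb]; simpa using h.zne)
  rw [Nr_comb, Nr_eq_ip] at h1
  simp only [zero_add, Int.cast_one] at h1 hmn
  have := h.E_div_le h₁ h₂
  linarith

/-- Hermite's inequality for a Minkowski reduced ternary form. -/
lemma mul_le_det (h₁ : c₁ < 0) (h₂ : c₂ < 0) (h : MinBasis O x y z) :
    3 * (ip x x * ip y y * ip z z) ≤
      8 * det3 (ip x x) (ip y y) (ip z z) (ip x y) (ip x z) (ip y z) := by
  have hA := h.A_pos h₁ h₂
  have hE := h.E_pos h₁ h₂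
  have hC := h.C_le h₁ h₂
  have hAB := h.A_le_B
  have hBC := h.B_le_C
  set D := det3 (ip x x) (ip y y) (ip z z) (ip x y) (ip x z) (ip y z)
  have h1 : ip z z / 2 ≤ D / (ip x x * ip y y - ip x y ^ 2) := by linarith
  rw [le_div_iff₀ hE] at h1
  have hR := h.R_le
  have h2 : 4 * ip x y ^ 2 ≤ ip x x * ip y y := by
    have : (2 * |ip x y|) ^ 2 ≤ ip x x ^ 2 := pow_le_pow_left₀ (by positivity) hR 2
    rw [mul_pow, sq_abs] at this
    nlinarith
  nlinarith

lemma gen (h₁ : c₁ < 0) (h₂ : c₂ < 0) (h : MinBasis O x y z) {v : ℍ[ℚ, c₁, c₂]}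
    (hv : v ∈ GrossLattice O) : ∃ a b c : ℤ, v = (a : ℚ) • x + (b : ℚ) • y + (c : ℚ) • z := by
  have hA := h.A_pos h₁ h₂
  have hE := h.E_pos h₁ h₂
  have hAB := h.A_le_B
  have hBC := h.B_le_C
  have hEB := h.E_div_le h₁ h₂
  have hD : det3 (ip x x) (ip y y) (ip z z) (ip x y) (ip x z) (ip y z) /
      (ip x x * ip y y - ip x y ^ 2) ≤ ip z z := by
    have := q3_eq_sum_squares (C := ip z z) (S := ip x z) (T := ip y z) hA.ne' hE.ne' 0 0 1
    have h3 := div_pos hE hA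
    have h4 : q3 (ip x x) (ip y y) (ip z z) (ip x y) (ip x z) (ip y z) 0 0 1 = ip z z := by
      simp [q3]
    rw [h4] at this
    have h5 := mul_nonneg hA.le (sq_nonneg (0 + (ip x y / ip x x * 0 + ip x z / ip x x * 1)))
    have h6 := mul_nonneg h3.le (sq_nonneg (0 + (ip x x * ip y z - ip x y * ip x z) /
      (ip x x * ip y y - ip x y ^ 2) * 1))
    linarith
  have small : ∀ q : ℚ, (q - round q) ^ 2 ≤ 1 / 4 := fun q => by
    have h := abs_sub_round q
    rw [abs_le] at h
    nlinarith
  obtain ⟨a, b, c, rfl⟩ := exists_comb h.rex h.rey h.rez (re_eq_zero_of_mem_GrossLattice hv) h.zne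
  have shift : ∀ m n k : ℤ,
      (a + m) • x + (b + n) • y + (c - k) • z ∈ GrossLattice O := fun m n k => by
    have := add_mem hv (h.comb_mem m n (-k))
    convert this using 1
    push_cast
    module
  have hc : c - round c = 0 := by
    by_contra hne
    obtain ⟨m, n, hmn⟩ := exists_q3_le hA hE (C := ip z z) (S := ip x z) (T := ip y z) a b
      (c - round c)
    have h1 := h.zmin _ (shift m n (round c)) (by
      rw [tri_comb]; exact mul_ne_zero hne h.zne)
    rw [Nr_comb, Nr_eq_ip] at h1
    have h2 := mul_le_mul_of_nonneg_left (small c) (div_pos h.det_pos hE).le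
    linarith
  have hb : b - round b = 0 := by
    by_contra hne
    obtain ⟨m, hm⟩ := exists_q2_le hA (B := ip y y) (R := ip x y) a (b - round b)
    have h1 := h.ymin _ (shift m (-round b) (round c)) (by
      rw [crs_comb, hc, zero_smul, add_zero]
      refine smul_ne_zero ?_ h.yne
      push_cast; rwa [← sub_eq_add_neg])
    rw [Nr_comb, Nr_eq_ip, hc] at h1
    push_cast at h1
    rw [← sub_eq_add_neg] at h1
    have h2 := mul_le_mul_of_nonneg_left (small b) (div_pos hE hA).le
    simp only [q3] at h1 hm
    linarith
  have ha : a - round a = 0 := by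
    by_contra hne
    have e : (a + ((-round a : ℤ) : ℚ)) • x + (b + ((-round b : ℤ) : ℚ)) • y +
        (c - round c) • z = (a - round a) • x := by
      push_cast
      rw [← sub_eq_add_neg, ← sub_eq_add_neg, hb, hc]; simp only [zero_smul, add_zero]
    have h1 := h.xmin _ (shift (-round a) (-round b) (round c)) (by
      rw [e]; exact smul_ne_zero hne (h.xne))
    rw [e, Nr_eq_ip, Nr_eq_ip, ip_smul_left, ip_smul_right] at h1
    have h2 := mul_le_mul_of_nonneg_left (small a) hA.le
    linarith
  refine ⟨round a, round b, round c, ?_⟩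
  congr 1
  · congr 1
    · rw [← sub_eq_zero.1 ha]
    · rw [← sub_eq_zero.1 hb]
  · rw [← sub_eq_zero.1 hc]

end MinBasis

end

lemma tri_crs_crs {x y z v : ℍ[ℚ, c₁, c₂]} (hx : x.re = 0) :
    tri (crs z x) (crs x y) v = tri x y z * ip x v := by
  simp only [tri_eq, ip_eq, crs_imI, crs_imJ, crs_imK, hx]; ring

lemma tri_comb_comb (x y z : ℍ[ℚ, c₁, c₂]) (a b c a' b' c' a'' b'' c'' : ℚ) :
    tri (a • x + b • y + c • z) (a' • x + b' • y + c' • z) (a'' • x + b'' • y + c'' • z) =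
      (a * (b' * c'' - c' * b'') - b * (a' * c'' - c' * a'') + c * (a' * b'' - b' * a'')) *
        tri x y z := by
  simp [tri_eq]; ring

lemma tri_rotate (x y z : ℍ[ℚ, c₁, c₂]) : tri y z x = tri x y z := by
  simp only [tri_eq]; ring

lemma crs_swap (x y : ℍ[ℚ, c₁, c₂]) : crs y x = - crs x y := by
  simp only [crs, ← smul_neg, neg_sub]

lemma crs_smul_smul (x y : ℍ[ℚ, c₁, c₂]) (q r : ℚ) : crs (q • x) (r • y) = (q * r) • crs x y := by
  ext <;> simp [crs_re, crs_imI, crs_imJ, crs_imK] <;> ring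

/-- The multiplication rules of a good basis of a quaternion order, in terms of the associated
basis `x, y, z` of the Gross lattice and the coefficients of the half-discriminant form. -/
structure CrossRel (a b c u v w : ℚ) (x y z : ℍ[ℚ, c₁, c₂]) : Prop where
  rex : x.re = 0
  rey : y.re = 0
  rez : z.re = 0
  yz : crs y z = -((2 * a) • x + w • y + v • z)
  zx : crs z x = -(w • x + (2 * b) • y + u • z)
  xy : crs x y = -(v • x + u • y + (2 * c) • z)
  ne : tri x y z ≠ 0

/-- The half-discriminant of a ternary quadratic form. -/
def halfDisc {K : Type*} [CommRing K] (a b c u v w : K) : K :=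
  4 * a * b * c + u * v * w - a * u ^ 2 - b * v ^ 2 - c * w ^ 2

namespace CrossRel

variable {a b c u v w : ℚ} {x y z : ℍ[ℚ, c₁, c₂]}

lemma rotate (h : CrossRel a b c u v w x y z) : CrossRel b c a v w u y z x where
  rex := h.rey
  rey := h.rez
  rez := h.rex
  yz := by rw [h.zx]; abel
  zx := by rw [h.xy]; abel
  xy := by rw [h.yz]; abel
  ne := by rw [tri_rotate]; exact h.ne

lemma swap (h : CrossRel a b c u v w x y z) : CrossRel b a c v u w (-y) (-x) (-z) where
  rex := by simp [h.rey]
  rey := by simp [h.rex]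
  rez := by simp [h.rez]
  yz := by
    have e : crs (-x) (-z) = - crs z x := by simp [crs, ← smul_neg]
    rw [e, h.zx]; module
  zx := by
    have e : crs (-z) (-y) = - crs y z := by simp [crs, ← smul_neg]
    rw [e, h.yz]; module
  xy := by
    have e : crs (-y) (-x) = - crs x y := by simp [crs, ← smul_neg]
    rw [e, h.xy]; module
  ne := by
    have e : tri (-y) (-x) (-z) = tri x y z := by simp [tri_eq, -mul_eq_mul_left_iff]; ring
    rw [e]; exact h.ne

lemma shear (h : CrossRel a b c u v w x y z) (m : ℚ) :
    CrossRel a b (c + m * v + m ^ 2 * a) (u + m * w) (v + 2 * m * a) w (x - m • z) y z where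
  rex := by simp [h.rex, h.rez]
  rey := h.rey
  rez := h.rez
  yz := by rw [h.yz]; module
  zx := by
    have e : crs z (x - m • z) = crs z x := by
      ext <;> simp [crs_re, crs_imI, crs_imJ, crs_imK, -mul_eq_mul_left_iff] <;> ring
    rw [e, h.zx]; module
  xy := by
    have e : crs (x - m • z) y = crs x y + m • crs y z := by
      ext <;> simp [crs_re, crs_imI, crs_imJ, crs_imK] <;> ring
    rw [e, h.xy, h.yz]; module
  ne := by
    have e : tri (x - m • z) y z = tri x y z := by simp [tri_eq, -mul_eq_mul_left_iff]; ring
    rw [e]; exact h.ne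

lemma scale (h : CrossRel a b c u v w x y z) {r s t : ℚ} (hr : r ≠ 0) (hs : s ≠ 0)
    (ht : t ≠ 0) :
    CrossRel (a * r / (s * t)) (b * s / (r * t)) (c * t / (r * s)) (u / r) (v / s) (w / t)
      (r⁻¹ • x) (s⁻¹ • y) (t⁻¹ • z) where
  rex := by simp [h.rex]
  rey := by simp [h.rey]
  rez := by simp [h.rez]
  yz := by
    rw [crs_smul_smul, h.yz]
    match_scalars <;> field_simp
  zx := by
    rw [crs_smul_smul, h.zx]
    match_scalars <;> field_simp
  xy := by
    rw [crs_smul_smul, h.xy]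
    match_scalars <;> field_simp
  ne := by
    have e : tri (r⁻¹ • x) (s⁻¹ • y) (t⁻¹ • z) = r⁻¹ * s⁻¹ * t⁻¹ * tri x y z := by
      simp [tri_eq]; ring
    rw [e]
    exact mul_ne_zero (by positivity) h.ne

lemma ip_comb (h : CrossRel a b c u v w x y z) (p q r : ℚ) :
    ip x (p • x + q • y + r • z) =
      (4 * b * c - u ^ 2) * p + (u * v - 2 * c * w) * q + (u * w - 2 * b * v) * r := by
  apply mul_left_cancel₀ h.ne
  have e (p q r : ℚ) : -(p • x + q • y + r • z) = (-p) • x + (-q) • y + (-r) • z := by module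
  rw [← tri_crs_crs h.rex, h.zx, h.xy, e, e, tri_comb_comb]
  ring

lemma ip_xx (h : CrossRel a b c u v w x y z) : ip x x = 4 * b * c - u ^ 2 := by
  simpa using h.ip_comb 1 0 0

lemma ip_xy (h : CrossRel a b c u v w x y z) : ip x y = u * v - 2 * c * w := by
  simpa using h.ip_comb 0 1 0

lemma ip_xz (h : CrossRel a b c u v w x y z) : ip x z = u * w - 2 * b * v := by
  simpa using h.ip_comb 0 0 1

lemma ip_yy (h : CrossRel a b c u v w x y z) : ip y y = 4 * a * c - v ^ 2 := by
  rw [h.rotate.ip_xx]; ring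

lemma ip_yz (h : CrossRel a b c u v w x y z) : ip y z = v * w - 2 * a * u := by
  rw [h.rotate.ip_xy]

lemma ip_zz (h : CrossRel a b c u v w x y z) : ip z z = 4 * a * b - w ^ 2 := by
  rw [h.rotate.rotate.ip_xx]

end CrossRel

section

variable {O : Subalgebra ℤ ℍ[ℚ, c₁, c₂]}

/-- A basis of the Gross lattice of an order satisfying the multiplication rules of a good
basis with integral coefficients. -/
structure GoodTriple (O : Subalgebra ℤ ℍ[ℚ, c₁, c₂]) (a b c u v w : ℤ)
    (x y z : ℍ[ℚ, c₁, c₂]) : Prop extends CrossRel (a : ℚ) b c u v w x y z where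
  memx : x ∈ GrossLattice O
  memy : y ∈ GrossLattice O
  memz : z ∈ GrossLattice O
  gen : ∀ h ∈ GrossLattice O, ∃ k l m : ℤ, h = (k : ℚ) • x + (l : ℚ) • y + (m : ℚ) • z

lemma smul_mem_GrossLattice {x : ℍ[ℚ, c₁, c₂]} (hx : x ∈ GrossLattice O) (m : ℤ) :
    (m : ℚ) • x ∈ GrossLattice O := by
  rw [Int.cast_smul_eq_zsmul]; exact zsmul_mem hx m

lemma crs_mem_GrossLattice {x y : ℍ[ℚ, c₁, c₂]} (hx : x ∈ GrossLattice O)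
    (hy : y ∈ GrossLattice O) : crs x y ∈ GrossLattice O := by
  obtain ⟨e, he, rfl⟩ := mem_GrossLattice.1 hx
  obtain ⟨f, hf, rfl⟩ := mem_GrossLattice.1 hy
  refine mem_GrossLattice.2 ⟨e * f - f * e, sub_mem (mul_mem he hf) (mul_mem hf he), ?_⟩
  ext <;> simp [crs_re, crs_imI, crs_imJ, crs_imK] <;> ring

/-- The coefficient of `z` in the cross product `x × y` is even. -/
lemma exists_crs_eq (hO : IsOrder O) {x y z : ℍ[ℚ, c₁, c₂]} (hx : x ∈ GrossLattice O)
    (hy : y ∈ GrossLattice O) (hne : tri x y z ≠ 0)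
    (hgen : ∀ h ∈ GrossLattice O, ∃ k l m : ℤ, h = (k : ℚ) • x + (l : ℚ) • y + (m : ℚ) • z) :
    ∃ p q r : ℤ, crs x y = (p : ℚ) • x + (q : ℚ) • y + (2 * (r : ℚ)) • z := by
  obtain ⟨p, q, r, hc⟩ := hgen _ (crs_mem_GrossLattice hx hy)
  obtain ⟨e, he, rfl⟩ := mem_GrossLattice.1 hx
  obtain ⟨f, hf, rfl⟩ := mem_GrossLattice.1 hy
  obtain ⟨s, hs⟩ := hO.exists_Trd he
  obtain ⟨t, ht⟩ := hO.exists_Trd hf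
  obtain ⟨k, l, m, hm⟩ := hgen _ (mem_GrossLattice.2 ⟨e * f, mul_mem he hf, rfl⟩)
  have h2 : (2 : ℚ) • (e * f - star (e * f)) =
      crs (e - star e) (f - star f) + (s : ℚ) • (f - star f) + (t : ℚ) • (e - star e) := by
    rw [← hs, ← ht]
    ext <;> simp [crs_re, crs_imI, crs_imJ, crs_imK, Trd_eq] <;> ring
  have h3 := congrArg (tri (e - star e) (f - star f)) h2
  have e1 : crs (e - star e) (f - star f) + (s : ℚ) • (f - star f) + (t : ℚ) • (e - star e) =
      (p + t : ℚ) • (e - star e) + (q + s : ℚ) • (f - star f) + (r : ℚ) • z := by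
    rw [hc]; module
  have e2 : (2 : ℚ) • ((k : ℚ) • (e - star e) + (l : ℚ) • (f - star f) + (m : ℚ) • z) =
      (2 * k : ℚ) • (e - star e) + (2 * l : ℚ) • (f - star f) + (2 * m : ℚ) • z := by
    module
  rw [e1, hm, e2, tri_comb, tri_comb] at h3
  have h4 := mul_right_cancel₀ hne h3
  exact ⟨p, q, m, by rw [h4]; exact hc⟩

lemma MinBasis.exists_goodTriple (h₁ : c₁ < 0) (h₂ : c₂ < 0) (hO : IsOrder O)
    {x y z : ℍ[ℚ, c₁, c₂]} (h : MinBasis O x y z) :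
    ∃ a b c u v w : ℤ, GoodTriple O a b c u v w x y z := by
  obtain ⟨p₁, q₁, r₁, e₁⟩ := exists_crs_eq hO (z := x) h.memy h.memz
    (by rw [tri_rotate]; exact h.zne) fun v hv => by
      obtain ⟨k, l, m, e⟩ := h.gen h₁ h₂ hv
      exact ⟨l, m, k, by rw [e]; abel⟩
  obtain ⟨p₂, q₂, r₂, e₂⟩ := exists_crs_eq hO (z := y) h.memz h.memx
    (by rw [← tri_rotate]; exact h.zne) fun v hv => by
      obtain ⟨k, l, m, e⟩ := h.gen h₁ h₂ hv
      exact ⟨m, k, l, by rw [e]; abel⟩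
  obtain ⟨p₃, q₃, r₃, e₃⟩ := exists_crs_eq hO (z := z) h.memx h.memy h.zne fun v hv =>
    h.gen h₁ h₂ hv
  have sym : ∀ {x y z : ℍ[ℚ, c₁, c₂]} {p q r p' q' r' : ℚ}, tri x y z ≠ 0 →
      crs y z = p • y + q • z + r • x → crs z x = p' • z + q' • x + r' • y → p = q' := by
    intro x y z p q r p' q' r' hne h1 h2
    have h3 : tri y z (crs z x) = tri z x (crs y z) := by rw [tri, tri, ip_comm]
    have e1 : p • y + q • z + r • x = q • z + r • x + p • y := by abel
    have e2 : p' • z + q' • x + r' • y = r' • y + p' • z + q' • x := by abel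
    rw [h1, h2, e1, e2, tri_comb, tri_comb, ← tri_rotate z x y, tri_rotate x y z] at h3
    exact (mul_right_cancel₀ hne h3).symm
  have s₁ := sym h.zne e₁ e₂
  have s₂ := sym (by rw [tri_rotate]; exact h.zne) e₂ e₃
  have s₃ := sym (by rw [← tri_rotate]; exact h.zne) e₃ e₁
  refine ⟨-r₁, -r₂, -r₃, -p₂, -p₃, -p₁, ⟨h.rex, h.rey, h.rez, ?_, ?_, ?_, h.zne⟩, h.memx, h.memy,
    h.memz, fun v hv => h.gen h₁ h₂ hv⟩
  · rw [e₁, ← s₃]; push_cast; module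
  · rw [e₂, ← s₁]; push_cast; module
  · rw [e₃, ← s₂]; push_cast; module

namespace GoodTriple

variable {a b c u v w : ℤ} {x y z : ℍ[ℚ, c₁, c₂]}

lemma rotate (h : GoodTriple O a b c u v w x y z) : GoodTriple O b c a v w u y z x where
  toCrossRel := h.toCrossRel.rotate
  memx := h.memy
  memy := h.memz
  memz := h.memx
  gen v hv := by
    obtain ⟨k, l, m, e⟩ := h.gen v hv
    exact ⟨l, m, k, by rw [e]; abel⟩

lemma swap (h : GoodTriple O a b c u v w x y z) :
    GoodTriple O b a c v u w (-y) (-x) (-z) where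
  toCrossRel := h.toCrossRel.swap
  memx := neg_mem h.memy
  memy := neg_mem h.memx
  memz := neg_mem h.memz
  gen v hv := by
    obtain ⟨k, l, m, e⟩ := h.gen v hv
    exact ⟨-l, -k, -m, by rw [e]; push_cast; module⟩

lemma shear (h : GoodTriple O a b c u v w x y z) (m : ℤ) :
    GoodTriple O a b (c + m * v + m ^ 2 * a) (u + m * w) (v + 2 * m * a) w
      (x - (m : ℚ) • z) y z where
  toCrossRel := by exact_mod_cast h.toCrossRel.shear m
  memx := sub_mem h.memx (smul_mem_GrossLattice h.memz m)
  memy := h.memy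
  memz := h.memz
  gen v hv := by
    obtain ⟨k, l, n, e⟩ := h.gen v hv
    exact ⟨k, l, n + k * m, by rw [e]; push_cast; module⟩

end GoodTriple

end

section

lemma half_mul {x y : ℍ[ℚ, c₁, c₂]} (hx : x.re = 0) (hy : y.re = 0) (u v : ℚ) :
    ((1 / 2 : ℚ) • (x + u • (1 : ℍ[ℚ, c₁, c₂]))) * ((1 / 2 : ℚ) • (y + v • (1 : ℍ[ℚ, c₁, c₂]))) =
      (1 / 4 : ℚ) • (crs x y + u • y + v • x + (u * v - ip x y) • (1 : ℍ[ℚ, c₁, c₂])) := by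
  ext <;> simp [crs_re, crs_imI, crs_imJ, crs_imK, ip_eq, hx, hy] <;> ring

lemma crs_self (x : ℍ[ℚ, c₁, c₂]) : crs x x = 0 := by simp [crs]

namespace CrossRel

section

variable {a b c u v w : ℚ} {x y z : ℍ[ℚ, c₁, c₂]}

lemma half_mul_self (h : CrossRel a b c u v w x y z) :
    ((1 / 2 : ℚ) • (x + u • (1 : ℍ[ℚ, c₁, c₂]))) * ((1 / 2 : ℚ) • (x + u • (1 : ℍ[ℚ, c₁, c₂]))) =
      u • ((1 / 2 : ℚ) • (x + u • (1 : ℍ[ℚ, c₁, c₂]))) - (b * c) • (1 : ℍ[ℚ, c₁, c₂]) := by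
  rw [half_mul h.rex h.rex, crs_self, h.ip_xx]
  module

lemma half_mul_half (h : CrossRel a b c u v w x y z) :
    ((1 / 2 : ℚ) • (x + u • (1 : ℍ[ℚ, c₁, c₂]))) * ((1 / 2 : ℚ) • (y + v • (1 : ℍ[ℚ, c₁, c₂]))) =
      (c * w) • (1 : ℍ[ℚ, c₁, c₂]) - c • ((1 / 2 : ℚ) • (z + w • (1 : ℍ[ℚ, c₁, c₂]))) := by
  rw [half_mul h.rex h.rey, h.xy, h.ip_xy]
  module

lemma half_mul_half_swap (h : CrossRel a b c u v w x y z) :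
    ((1 / 2 : ℚ) • (y + v • (1 : ℍ[ℚ, c₁, c₂]))) * ((1 / 2 : ℚ) • (x + u • (1 : ℍ[ℚ, c₁, c₂]))) =
      c • ((1 / 2 : ℚ) • (z + w • (1 : ℍ[ℚ, c₁, c₂]))) +
        u • ((1 / 2 : ℚ) • (y + v • (1 : ℍ[ℚ, c₁, c₂]))) +
        v • ((1 / 2 : ℚ) • (x + u • (1 : ℍ[ℚ, c₁, c₂]))) - (u * v) • (1 : ℍ[ℚ, c₁, c₂]) := by
  rw [half_mul h.rey h.rex, crs_swap, h.xy, ip_comm, h.ip_xy]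
  module

end

variable {a b c u v w : ℤ} {x y z : ℍ[ℚ, c₁, c₂]}

/-- The lattice spanned by a good basis. -/
noncomputable def lattice (u v w : ℤ) (x y z : ℍ[ℚ, c₁, c₂]) : Submodule ℤ ℍ[ℚ, c₁, c₂] :=
  Submodule.span ℤ {1, (1 / 2 : ℚ) • (x + (u : ℚ) • (1 : ℍ[ℚ, c₁, c₂])),
    (1 / 2 : ℚ) • (y + (v : ℚ) • (1 : ℍ[ℚ, c₁, c₂])),
    (1 / 2 : ℚ) • (z + (w : ℚ) • (1 : ℍ[ℚ, c₁, c₂]))}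

lemma smul_mem_lattice {h : ℍ[ℚ, c₁, c₂]} (hh : h ∈ lattice u v w x y z) (m : ℤ) :
    (m : ℚ) • h ∈ lattice u v w x y z := by
  rw [Int.cast_smul_eq_zsmul]; exact Submodule.smul_mem _ m hh

lemma one_mem_lattice : (1 : ℍ[ℚ, c₁, c₂]) ∈ lattice u v w x y z :=
  Submodule.subset_span (by simp)

lemma half_mem_lattice : (1 / 2 : ℚ) • (x + (u : ℚ) • (1 : ℍ[ℚ, c₁, c₂])) ∈
    lattice u v w x y z := Submodule.subset_span (by simp)

lemma lattice_rotate : lattice v w u y z x = lattice u v w x y z := by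
  rw [lattice, lattice]
  congr 1
  ext; simp only [Set.mem_insert_iff, Set.mem_singleton_iff]; tauto

lemma half_mem_lattice' : (1 / 2 : ℚ) • (y + (v : ℚ) • (1 : ℍ[ℚ, c₁, c₂])) ∈
    lattice u v w x y z := by rw [← lattice_rotate]; exact half_mem_lattice

lemma half_mem_lattice'' : (1 / 2 : ℚ) • (z + (w : ℚ) • (1 : ℍ[ℚ, c₁, c₂])) ∈
    lattice u v w x y z := by rw [← lattice_rotate]; exact half_mem_lattice'

lemma mul_mem_lattice_aux (h : CrossRel (a : ℚ) b c u v w x y z) :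
    ((1 / 2 : ℚ) • (x + (u : ℚ) • (1 : ℍ[ℚ, c₁, c₂]))) *
      ((1 / 2 : ℚ) • (x + (u : ℚ) • (1 : ℍ[ℚ, c₁, c₂]))) ∈ lattice u v w x y z ∧
    ((1 / 2 : ℚ) • (x + (u : ℚ) • (1 : ℍ[ℚ, c₁, c₂]))) *
      ((1 / 2 : ℚ) • (y + (v : ℚ) • (1 : ℍ[ℚ, c₁, c₂]))) ∈ lattice u v w x y z ∧
    ((1 / 2 : ℚ) • (y + (v : ℚ) • (1 : ℍ[ℚ, c₁, c₂]))) *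
      ((1 / 2 : ℚ) • (x + (u : ℚ) • (1 : ℍ[ℚ, c₁, c₂]))) ∈ lattice u v w x y z := by
  rw [h.half_mul_self, h.half_mul_half, h.half_mul_half_swap]
  refine ⟨sub_mem (smul_mem_lattice half_mem_lattice u) ?_,
    sub_mem ?_ (smul_mem_lattice half_mem_lattice'' c),
    sub_mem (add_mem (add_mem (smul_mem_lattice half_mem_lattice'' c)
      (smul_mem_lattice half_mem_lattice' u)) (smul_mem_lattice half_mem_lattice v)) ?_⟩
  all_goals exact_mod_cast smul_mem_lattice one_mem_lattice _

lemma lattice_mul_le (h : CrossRel (a : ℚ) b c u v w x y z) :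
    lattice u v w x y z * lattice u v w x y z ≤ lattice u v w x y z := by
  obtain ⟨h1, h2, h3⟩ := h.mul_mem_lattice_aux
  obtain ⟨h4, h5, h6⟩ := h.rotate.mul_mem_lattice_aux
  obtain ⟨h7, h8, h9⟩ := h.rotate.rotate.mul_mem_lattice_aux
  rw [lattice_rotate] at h4 h5 h6
  rw [← lattice_rotate] at h7 h8 h9
  conv_lhs => rw [lattice, Submodule.span_mul_span]
  rw [Submodule.span_le, Set.mul_subset_iff]
  have o := one_mem_lattice (u := u) (v := v) (w := w) (x := x) (y := y) (z := z)
  have i1 := half_mem_lattice (u := u) (v := v) (w := w) (x := x) (y := y) (z := z)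
  have i2 := half_mem_lattice' (u := u) (v := v) (w := w) (x := x) (y := y) (z := z)
  have i3 := half_mem_lattice'' (u := u) (v := v) (w := w) (x := x) (y := y) (z := z)
  simp only [Set.mem_insert_iff, Set.mem_singleton_iff]
  rintro e (rfl | rfl | rfl | rfl) f (rfl | rfl | rfl | rfl)
  all_goals first
    | (rw [one_mul]; assumption)
    | (rw [mul_one]; assumption)
    | assumption

/-- The order spanned by a good basis. -/
noncomputable def order (h : CrossRel (a : ℚ) b c u v w x y z) : Subalgebra ℤ ℍ[ℚ, c₁, c₂] :=
  (lattice u v w x y z).toSubalgebra one_mem_lattice fun _ _ he hf =>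
    h.lattice_mul_le (Submodule.mul_mem_mul he hf)

lemma mem_order (h : CrossRel (a : ℚ) b c u v w x y z) {e : ℍ[ℚ, c₁, c₂]} :
    e ∈ h.order ↔ e ∈ lattice u v w x y z := Iff.rfl

lemma isOrder (h : CrossRel (a : ℚ) b c u v w x y z) : IsOrder h.order := by
  constructor
  · exact Submodule.fg_span (Set.toFinite _)
  · rw [eq_top_iff]
    intro e _
    set S := Submodule.span ℚ (h.order : Set ℍ[ℚ, c₁, c₂])
    have ho : (1 : ℍ[ℚ, c₁, c₂]) ∈ S := Submodule.subset_span h.order.one_mem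
    have key : ∀ (x : ℍ[ℚ, c₁, c₂]) (u : ℚ), (1 / 2 : ℚ) • (x + u • (1 : ℍ[ℚ, c₁, c₂])) ∈ S →
        x ∈ S := fun x u hx => by
      have e : x = (2 : ℚ) • ((1 / 2 : ℚ) • (x + u • (1 : ℍ[ℚ, c₁, c₂]))) - u • 1 := by module
      rw [e]
      exact sub_mem (S.smul_mem _ hx) (S.smul_mem _ ho)
    have hx := key x _ (Submodule.subset_span (h.mem_order.2 half_mem_lattice))
    have hy := key y _ (Submodule.subset_span (h.mem_order.2 half_mem_lattice'))
    have hz := key z _ (Submodule.subset_span (h.mem_order.2 half_mem_lattice''))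
    obtain ⟨k, l, m, he⟩ := exists_comb h.rex h.rey h.rez
      (v := e - e.re • (1 : ℍ[ℚ, c₁, c₂])) (by simp) h.ne
    rw [sub_eq_iff_eq_add] at he
    rw [he]
    exact add_mem (add_mem (add_mem (S.smul_mem _ hx) (S.smul_mem _ hy)) (S.smul_mem _ hz))
      (S.smul_mem _ ho)

end CrossRel

end

section

namespace GoodTriple

variable {O : Subalgebra ℤ ℍ[ℚ, c₁, c₂]} {a b c u v w : ℤ} {x y z : ℍ[ℚ, c₁, c₂]}

lemma Nr_comb (h : GoodTriple O a b c u v w x y z) (k l m : ℚ) :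
    Nr (k • x + l • y + m • z) = 4 * (b * c * k ^ 2 + a * c * l ^ 2 + a * b * m ^ 2
      - c * w * k * l - b * v * k * m - a * u * l * m) - (u * k - v * l - w * m) ^ 2
      + 4 * (w * v * l * m) := by
  rw [_root_.Nr_comb, q3, h.ip_xx, h.ip_yy, h.ip_zz, h.ip_xy, h.ip_xz, h.ip_yz]
  ring

lemma exists_eq_of_mem (hO : IsOrder O) (h : GoodTriple O a b c u v w x y z)
    {e : ℍ[ℚ, c₁, c₂]} (he : e ∈ O) : ∃ n k l m : ℤ,
    e = (n : ℚ) • (1 : ℍ[ℚ, c₁, c₂]) + (k : ℚ) • (1 / 2 : ℚ) • (x + (u : ℚ) • (1 : ℍ[ℚ, c₁, c₂]))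
      + (l : ℚ) • (1 / 2 : ℚ) • (y + (v : ℚ) • (1 : ℍ[ℚ, c₁, c₂]))
      + (m : ℚ) • (1 / 2 : ℚ) • (z + (w : ℚ) • (1 : ℍ[ℚ, c₁, c₂])) := by
  obtain ⟨hg, t, n, ht, hn, htn⟩ := (mem_order_iff hO).1 he
  obtain ⟨k, l, m, hk⟩ := h.gen _ hg
  rw [hk, h.Nr_comb] at hn
  have hpar : (2 : ℤ) ∣ t - (k * u + l * v + m * w) := by
    have hn' : n = 4 * (b * c * k ^ 2 + a * c * l ^ 2 + a * b * m ^ 2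
      - c * w * k * l - b * v * k * m - a * u * l * m) - (u * k - v * l - w * m) ^ 2
      + 4 * (w * v * l * m) := by exact_mod_cast hn.symm
    have h1 : (2 : ℤ) ∣ (u * k - v * l - w * m) ^ 2 - (u * k - v * l - w * m) := by
      rw [sq, ← mul_sub_one]
      exact (Int.even_mul_pred_self _).two_dvd
    obtain ⟨i, hi⟩ := h1
    obtain ⟨j, hj⟩ := htn
    refine ⟨j - i + 2 * (b * c * k ^ 2 + a * c * l ^ 2 + a * b * m ^ 2
      - c * w * k * l - b * v * k * m - a * u * l * m) + 2 * (w * v * l * m)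
      - u * k, ?_⟩
    linear_combination hj + hn' - hi
  obtain ⟨i, hi⟩ := hpar
  refine ⟨i, k, l, m, ?_⟩
  have h2 : e = (1 / 2 : ℚ) • (e - star e + (Trd e) • (1 : ℍ[ℚ, c₁, c₂])) := by
    ext <;> simp [Trd_eq] <;> ring
  have hi' : (t : ℚ) = 2 * i + (k * u + l * v + m * w) := by
    have : t = 2 * i + (k * u + l * v + m * w) := by linarith
    exact_mod_cast this
  rw [h2, hk, ht, hi']
  module

/-- A maximal order has no proper overorder obtained by rescaling a good basis. -/
lemma isUnit_of_scale (hO : IsMaximalOrder O) {r s t a' b' c' : ℤ} (hr : r ≠ 0) (hs : s ≠ 0)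
    (ht : t ≠ 0) (h : GoodTriple O a b c (r * u) (s * v) (t * w) x y z)
    (ha : a * r = a' * (s * t)) (hb : b * s = b' * (r * t)) (hc : c * t = c' * (r * s)) :
    IsUnit s := by
  have hr' : (r : ℚ) ≠ 0 := by exact_mod_cast hr
  have hs' : (s : ℚ) ≠ 0 := by exact_mod_cast hs
  have ht' : (t : ℚ) ≠ 0 := by exact_mod_cast ht
  have hC : CrossRel (a' : ℚ) b' c' u v w ((r : ℚ)⁻¹ • x) ((s : ℚ)⁻¹ • y) ((t : ℚ)⁻¹ • z) := by
    have ha' : (a : ℚ) * r / (s * t) = a' := by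
      rw [div_eq_iff (by positivity)]; exact_mod_cast ha
    have hb' : (b : ℚ) * s / (r * t) = b' := by
      rw [div_eq_iff (by positivity)]; exact_mod_cast hb
    have hc' : (c : ℚ) * t / (r * s) = c' := by
      rw [div_eq_iff (by positivity)]; exact_mod_cast hc
    have := h.toCrossRel.scale hr' hs' ht'
    rw [ha', hb', hc'] at this
    push_cast at this
    rwa [mul_div_cancel_left₀ _ hr', mul_div_cancel_left₀ _ hs', mul_div_cancel_left₀ _ ht'] at this
  have hle : O ≤ hC.order := fun e he => by
    obtain ⟨n, k, l, m, rfl⟩ := h.exists_eq_of_mem hO.1 he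
    have e1 : ∀ (r : ℤ) (k : ℤ) (u : ℤ) (x : ℍ[ℚ, c₁, c₂]), (r : ℚ) ≠ 0 →
        (k : ℚ) • (1 / 2 : ℚ) • (x + ((r * u : ℤ) : ℚ) • (1 : ℍ[ℚ, c₁, c₂])) =
        ((k * r : ℤ) : ℚ) • (1 / 2 : ℚ) • ((r : ℚ)⁻¹ • x + (u : ℚ) • (1 : ℍ[ℚ, c₁, c₂])) := by
      intro r k u x hr
      push_cast
      match_scalars <;> field_simp
    rw [e1 r k u x hr', e1 s l v y hs', e1 t m w z ht', CrossRel.mem_order]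
    exact add_mem (add_mem (add_mem
      (CrossRel.smul_mem_lattice CrossRel.one_mem_lattice _)
      (CrossRel.smul_mem_lattice CrossRel.half_mem_lattice _))
      (CrossRel.smul_mem_lattice CrossRel.half_mem_lattice' _))
      (CrossRel.smul_mem_lattice CrossRel.half_mem_lattice'' _)
  have heq := hO.2 _ hC.isOrder hle
  have hy : (s : ℚ)⁻¹ • y ∈ GrossLattice O := by
    refine mem_GrossLattice.2 ⟨(1 / 2 : ℚ) • ((s : ℚ)⁻¹ • y + (v : ℚ) • (1 : ℍ[ℚ, c₁, c₂])), ?_, ?_⟩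
    · rw [← heq, CrossRel.mem_order]; exact CrossRel.half_mem_lattice'
    · ext <;> simp [h.rey] <;> ring
  obtain ⟨k, l, m, hk⟩ := h.gen _ hy
  have h1 := congrArg (tri z x) hk
  have e2 : (k : ℚ) • x + (l : ℚ) • y + (m : ℚ) • z =
    (m : ℚ) • z + (k : ℚ) • x + (l : ℚ) • y := by abel
  rw [e2, tri_comb, tri, ip_smul_right, ← tri] at h1
  have hne : tri z x y ≠ 0 := by rw [← tri_rotate]; exact h.ne
  have h2 := mul_right_cancel₀ hne h1
  rw [inv_eq_iff_eq_inv, eq_comm, inv_eq_iff_eq_inv, eq_comm] at h2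
  have h3 : (s : ℚ) * l = 1 := by
    rw [← h2]
    field_simp
  have h4 : s * l = 1 := by exact_mod_cast h3
  exact IsUnit.of_mul_eq_one _ h4

end GoodTriple

end

section

lemma Prime.exists_mul_eq_one_add {l x : ℤ} (hl : Prime l) (hx : ¬ l ∣ x) :
    ∃ t k : ℤ, t * x = 1 + l * k := by
  obtain ⟨i, j, h⟩ := ((Prime.coprime_iff_not_dvd hl).2 hx)
  exact ⟨j, -i, by linear_combination h⟩

lemma halfDisc_rotate {K : Type*} [CommRing K] (a b c u v w : K) :
    halfDisc b c a v w u = halfDisc a b c u v w := by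
  simp only [halfDisc]; ring

/-- There is a good basis with the given coefficients. -/
def HasGood (O : Subalgebra ℤ ℍ[ℚ, c₁, c₂]) (a b c u v w : ℤ) : Prop :=
  ∃ x y z, GoodTriple O a b c u v w x y z

namespace HasGood

variable {O : Subalgebra ℤ ℍ[ℚ, c₁, c₂]} {a b c u v w : ℤ}

lemma rotate (h : HasGood O a b c u v w) : HasGood O b c a v w u := by
  obtain ⟨x, y, z, h⟩ := h; exact ⟨_, _, _, h.rotate⟩

lemma swap (h : HasGood O a b c u v w) : HasGood O b a c v u w := by
  obtain ⟨x, y, z, h⟩ := h; exact ⟨_, _, _, h.swap⟩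

lemma shear (h : HasGood O a b c u v w) (m : ℤ) :
    HasGood O a b (c + m * v + m ^ 2 * a) (u + m * w) (v + 2 * m * a) w := by
  obtain ⟨x, y, z, h⟩ := h; exact ⟨_, _, _, h.shear m⟩

lemma shear' (h : HasGood O a b c u v w) (m : ℤ) :
    HasGood O a (b + m * w + m ^ 2 * a) c (u + m * v) v (w + 2 * m * a) :=
  (h.swap.rotate.shear m).swap.rotate

lemma shear₂ (h : HasGood O a b c u v w) (m n : ℤ) :
    HasGood O a b (a * m ^ 2 + b * n ^ 2 + c + u * n + v * m + w * m * n)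
      (w * m + 2 * b * n + u) (2 * a * m + w * n + v) w := by
  have := (((h.shear m).swap).shear n).swap
  convert this using 1 <;> ring

lemma exists_dvd_of_not_dvd {l : ℤ} (hl : Prime l) (hD : l ∣ halfDisc a b c u v w)
    (hn : ¬ l ∣ 4 * a * b - w ^ 2) (h : HasGood O a b c u v w) :
    ∃ a' b' c' u' v' w' : ℤ, HasGood O a' b' c' u' v' w' ∧
      halfDisc a' b' c' u' v' w' = halfDisc a b c u v w ∧ l ∣ c' ∧ l ∣ u' ∧ l ∣ v' := by
  obtain ⟨t, k, ht⟩ := hl.exists_mul_eq_one_add hn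
  obtain ⟨d, hd⟩ := hD
  rw [halfDisc] at hd
  refine ⟨_, _, _, _, _, _, h.shear₂ (t * (u * w - 2 * b * v)) (t * (v * w - 2 * a * u)),
    ?_, ?_, ?_, ?_⟩
  · simp only [halfDisc]; ring
  · refine ⟨t ^ 2 * d * (4 * a * b - w ^ 2) -
      (2 * k + l * k ^ 2) * c - (u * (v * w - 2 * a * u) + v * (u * w - 2 * b * v)) * t * k, ?_⟩
    linear_combination t ^ 2 * (4 * a * b - w ^ 2) * hd - 
      (c * (t * (4 * a * b - w ^ 2) + 1 + l * k) +
        t * (u * (v * w - 2 * a * u) + v * (u * w - 2 * b * v))) * ht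
  · refine ⟨- u * k, ?_⟩
    linear_combination -u * ht
  · refine ⟨- v * k, ?_⟩
    linear_combination -v * ht

lemma exists_dvd_of_odd {l : ℤ} (hl : Prime l) (h2 : ¬ l ∣ 2)
    (ha : ¬ l ∣ a) (h₁ : l ∣ 4 * a * c - v ^ 2) (h₂ : l ∣ v * w - 2 * a * u)
    (h : HasGood O a b c u v w) :
    ∃ a' b' c' u' v' w' : ℤ, HasGood O a' b' c' u' v' w' ∧
      halfDisc a' b' c' u' v' w' = halfDisc a b c u v w ∧ l ∣ c' ∧ l ∣ u' ∧ l ∣ v' := by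
  have hn : ¬ l ∣ 2 * a := fun h => (hl.dvd_or_dvd h).elim h2 ha
  obtain ⟨t, k, ht⟩ := hl.exists_mul_eq_one_add hn
  obtain ⟨i, hi⟩ := h₁
  obtain ⟨j, hj⟩ := h₂
  refine ⟨_, _, _, _, _, _, h.shear (- t * v), ?_, ?_, ?_, ?_⟩
  · simp only [halfDisc]; ring
  · have hn4 : ¬ l ∣ 2 * (2 * a) := fun h => (hl.dvd_or_dvd h).elim h2 hn
    refine (hl.dvd_or_dvd (b := 2 * (2 * a)) ?_).resolve_right hn4
    rw [mul_comm]
    refine ⟨i + v ^ 2 * l * k ^ 2, ?_⟩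
    linear_combination hi + v ^ 2 * (2 * a * t - 1 + l * k) * ht
  · refine (hl.dvd_or_dvd (b := 2 * a) ?_).resolve_right hn
    refine ⟨- j - v * w * k, ?_⟩
    linear_combination - hj - v * w * ht
  · refine ⟨- v * k, ?_⟩
    linear_combination -v * ht

/-- A good basis can be chosen adapted to the radical of the form modulo a prime divisor of the
half-discriminant. -/
lemma exists_dvd {l : ℤ} (hl : Prime l) (hD : l ∣ halfDisc a b c u v w)
    (h : HasGood O a b c u v w) :
    ∃ a' b' c' u' v' w' : ℤ, HasGood O a' b' c' u' v' w' ∧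
      halfDisc a' b' c' u' v' w' = halfDisc a b c u v w ∧ l ∣ c' ∧ l ∣ u' ∧ l ∣ v' := by
  by_cases h1 : l ∣ 4 * a * b - w ^ 2
  swap
  · exact h.exists_dvd_of_not_dvd hl hD h1
  by_cases h2 : l ∣ 4 * b * c - u ^ 2
  swap
  · rw [← halfDisc_rotate] at hD ⊢
    exact h.rotate.exists_dvd_of_not_dvd hl hD h2
  by_cases h3 : l ∣ 4 * c * a - v ^ 2
  swap
  · rw [← halfDisc_rotate, ← halfDisc_rotate] at hD ⊢
    exact h.rotate.rotate.exists_dvd_of_not_dvd hl hD h3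
  by_cases htwo : l ∣ 2
  · have hev : ∀ {a b w : ℤ}, l ∣ 4 * a * b - w ^ 2 → l ∣ w := fun {a b w} h => by
      have h4 : l ∣ 4 * a * b := (htwo.trans (by norm_num)).mul_right a |>.mul_right b
      exact hl.dvd_of_dvd_pow ((dvd_sub_right h4).1 h)
    have hw := hev h1
    have hu := hev h2
    have hv := hev h3
    by_cases hc : l ∣ c
    · exact ⟨_, _, _, _, _, _, h, rfl, hc, hu, hv⟩
    by_cases ha : l ∣ a
    · exact ⟨_, _, _, _, _, _, h.rotate, halfDisc_rotate .., ha, hv, hw⟩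
    have hodd : ∀ x : ℤ, ¬ l ∣ x → ∃ k, x = 1 + 2 * k := fun x hx => by
      rcases Int.even_or_odd x with he | ⟨k, hk⟩
      · exact absurd (htwo.trans he.two_dvd) hx
      · exact ⟨k, by rw [hk]; ring⟩
    obtain ⟨i, hi⟩ := hodd a ha
    obtain ⟨j, hj⟩ := hodd c hc
    refine ⟨_, _, _, _, _, _, h.shear 1, ?_, ?_, ?_, ?_⟩
    · simp only [halfDisc]; ring
    · have e : c + 1 * v + 1 ^ 2 * a = v + 2 * (1 + i + j) := by rw [hi, hj]; ring
      rw [e]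
      exact dvd_add hv (htwo.mul_right _)
    · rw [one_mul]; exact dvd_add hu hw
    · exact dvd_add hv ((htwo.mul_right _).mul_right _)
  · have hrank : ∀ {a b c u v w : ℤ}, l ∣ halfDisc a b c u v w → l ∣ 4 * a * b - w ^ 2 →
        l ∣ v * w - 2 * a * u := by
      rintro a b c u v w ⟨d, hd⟩ ⟨e, he⟩
      refine hl.dvd_of_dvd_pow (n := 2) ⟨e * (4 * a * c - v ^ 2) - 4 * a * d, ?_⟩
      rw [halfDisc] at hd
      linear_combination (4 * a * c - v ^ 2) * he - 4 * a * hd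
    by_cases ha : l ∣ a
    swap
    · exact h.exists_dvd_of_odd hl htwo ha (by convert h3 using 1; ring) (hrank hD h1)
    by_cases hb : l ∣ b
    swap
    · rw [← halfDisc_rotate] at hD ⊢
      exact h.rotate.exists_dvd_of_odd hl htwo hb (by convert h1 using 1; ring) (hrank hD h2)
    by_cases hc : l ∣ c
    swap
    · rw [← halfDisc_rotate, ← halfDisc_rotate] at hD ⊢
      exact h.rotate.rotate.exists_dvd_of_odd hl htwo hc (by convert h2 using 1; ring)
        (hrank hD h3)
    have hz : ∀ {a b w : ℤ}, l ∣ b → l ∣ 4 * a * b - w ^ 2 → l ∣ w := fun {a b w} hb h =>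
      hl.dvd_of_dvd_pow ((dvd_sub_right (hb.mul_left (4 * a))).1 h)
    exact ⟨_, _, _, _, _, _, h, rfl, hc, hz hc h2, hz ha h3⟩

/-- Local conditions at a prime dividing the discriminant of a maximal order. -/
lemma local_conditions {l : ℤ} (hl : Prime l) (hO : IsMaximalOrder O)
    (h : HasGood O a b c u v w) (hc : l ∣ c) (hu : l ∣ u) (hv : l ∣ v) :
    ¬ l ^ 2 ∣ c ∧ ∀ m n, l ∣ a * m ^ 2 + w * m * n + b * n ^ 2 → l ∣ m ∧ l ∣ n := by
  have key : ∀ {a b c u v w : ℤ}, HasGood O a b c u v w → l ∣ c → l ∣ v → ¬ l ∣ a := by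
    rintro a b _ u _ w ⟨x, y, z, h⟩ ⟨c', rfl⟩ ⟨v', rfl⟩ ⟨a', rfl⟩
    refine hl.not_isUnit ?_
    refine GoodTriple.isUnit_of_scale hO one_ne_zero hl.ne_zero one_ne_zero (u := u) (v := v')
      (w := w) (x := x) (y := y) (z := z) (a := l * a') (b := b) (c := l * c') (a' := a')
      (b' := b * l) (c' := c') ?_ (by ring) (by ring) (by ring)
    simpa using h
  constructor
  · rintro ⟨c', rfl⟩
    obtain ⟨u', rfl⟩ := hu
    obtain ⟨v', rfl⟩ := hv
    obtain ⟨x, y, z, h⟩ := h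
    refine hl.not_isUnit ?_
    refine GoodTriple.isUnit_of_scale hO hl.ne_zero hl.ne_zero one_ne_zero (u := u') (v := v')
      (w := w) (x := x) (y := y) (z := z) (a := a) (b := b) (c := l ^ 2 * c') (a' := a)
      (b' := b) (c' := c') ?_ (by ring) (by ring) (by ring)
    simpa using h
  · intro m n hmn
    have hn : l ∣ n := by
      by_contra hn
      obtain ⟨t, k, ht⟩ := hl.exists_mul_eq_one_add hn
      refine key (h.shear' (m * t)).swap hc (dvd_add hu (hv.mul_left _)) ?_
      obtain ⟨d, hd⟩ := hmn
      refine ⟨t ^ 2 * d - w * m * t * k - b * (2 * k + l * k ^ 2), ?_⟩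
      linear_combination t ^ 2 * hd - (w * m * t + b * (t * n + 1 + l * k)) * ht
    refine ⟨?_, hn⟩
    have h1 : l ∣ a * m ^ 2 := by
      rw [show a * m ^ 2 = a * m ^ 2 + w * m * n + b * n ^ 2 - (w * m + b * n) * n by ring]
      exact dvd_sub hmn (hn.mul_left _)
    exact hl.dvd_of_dvd_pow ((hl.dvd_or_dvd h1).resolve_left (key h hc hv))

lemma not_sq_dvd_halfDisc {l : ℤ} (hl : Prime l) (hc : l ∣ c) (hu : l ∣ u) (hv : l ∣ v)
    (hc' : ¬ l ^ 2 ∣ c) (hani : ∀ m n, l ∣ a * m ^ 2 + w * m * n + b * n ^ 2 → l ∣ m ∧ l ∣ n) :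
    ¬ l ^ 2 ∣ halfDisc a b c u v w := by
  have ha : ¬ l ∣ a := fun h => hl.not_isUnit (isUnit_of_dvd_one (hani 1 0 (by simpa using h)).1)
  have hdisc : ¬ l ∣ 4 * a * b - w ^ 2 := by
    intro h
    by_cases htwo : l ∣ 2
    · have h4 : l ∣ 4 * a * b := (htwo.trans (by norm_num)).mul_right a |>.mul_right b
      have hw : l ∣ w := hl.dvd_of_dvd_pow ((dvd_sub_right h4).1 h)
      have hb : ¬ l ∣ b := fun h =>
        hl.not_isUnit (isUnit_of_dvd_one (hani 0 1 (by simpa using h)).2)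
      have hodd : ∀ x : ℤ, ¬ l ∣ x → ∃ k, x = 1 + 2 * k := fun x hx => by
        rcases Int.even_or_odd x with he | ⟨k, hk⟩
        · exact absurd (htwo.trans he.two_dvd) hx
        · exact ⟨k, by rw [hk]; ring⟩
      obtain ⟨i, hi⟩ := hodd a ha
      obtain ⟨j, hj⟩ := hodd b hb
      refine hl.not_isUnit (isUnit_of_dvd_one (hani 1 1 ?_).1)
      have e : a * 1 ^ 2 + w * 1 * 1 + b * 1 ^ 2 = w + 2 * (1 + i + j) := by rw [hi, hj]; ring
      rw [e]
      exact dvd_add hw (htwo.mul_right _)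
    · have h1 : l ∣ a * (-w) ^ 2 + w * (-w) * (2 * a) + b * (2 * a) ^ 2 := by
        rw [show a * (-w) ^ 2 + w * (-w) * (2 * a) + b * (2 * a) ^ 2 =
          a * (4 * a * b - w ^ 2) by ring]
        exact h.mul_left a
      exact ((hl.dvd_or_dvd (hani _ _ h1).2).elim htwo ha)
  obtain ⟨u', rfl⟩ := hu
  obtain ⟨v', rfl⟩ := hv
  intro h
  have h1 : l ^ 2 ∣ c * (4 * a * b - w ^ 2) := by
    rw [show c * (4 * a * b - w ^ 2) = halfDisc a b c (l * u') (l * v') w -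
      l ^ 2 * (u' * v' * w - a * u' ^ 2 - b * v' ^ 2) by simp only [halfDisc]; ring]
    exact dvd_sub h (dvd_mul_right _ _)
  obtain ⟨c', rfl⟩ := hc
  rw [sq, mul_assoc] at h1
  have h2 := (mul_dvd_mul_iff_left hl.ne_zero).1 h1
  have h3 := (hl.dvd_or_dvd h2).resolve_right hdisc
  exact hc' (by rw [sq]; exact mul_dvd_mul_left l h3)

end HasGood

/-- The norm form of an order in terms of a good basis. -/
def normForm {K : Type*} [CommRing K] (a b c u v w t x y z : K) : K :=
  t ^ 2 + t * (u * x + v * y + w * z) + b * c * x ^ 2 + a * c * y ^ 2 + a * b * z ^ 2 +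
    (u * v - c * w) * x * y + (u * w - b * v) * x * z + (v * w - a * u) * y * z

lemma dvd_of_sq_dvd_normForm {R : Type*} [CommRing R] [IsDomain R] {a b c u v w l : R}
    (hl : Prime l) (hc : l ∣ c) (hu : l ∣ u) (hv : l ∣ v) (hc' : ¬ l ^ 2 ∣ c)
    (hani : ∀ m n, l ∣ a * m ^ 2 + w * m * n + b * n ^ 2 → l ∣ m ∧ l ∣ n) {t x y z : R}
    (h : l ^ 2 ∣ normForm a b c u v w t x y z) : l ∣ t ∧ l ∣ x ∧ l ∣ y ∧ l ∣ z := by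
  have ha : ¬ l ∣ a := fun h => hl.not_isUnit (isUnit_of_dvd_one (hani 1 0 (by simpa using h)).1)
  obtain ⟨c, rfl⟩ := hc
  obtain ⟨u, rfl⟩ := hu
  obtain ⟨v, rfl⟩ := hv
  obtain ⟨d, hd⟩ := h
  rw [normForm] at hd
  have h1 : l ∣ a * t ^ 2 + w * t * (a * z) + b * (a * z) ^ 2 := by
    refine ⟨a * (l * d - (t * (u * x + v * y) + b * c * x ^ 2 + a * c * y ^ 2 +
      (l * u * v - c * w) * x * y + (u * w - b * v) * x * z + (v * w - a * u) * y * z)), ?_⟩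
    linear_combination a * hd
  obtain ⟨ht, hz⟩ := hani _ _ h1
  replace hz := (hl.dvd_or_dvd hz).resolve_left ha
  obtain ⟨t, rfl⟩ := ht
  obtain ⟨z, rfl⟩ := hz
  have h2 : l ∣ c * (a * (-y) ^ 2 + w * (-y) * x + b * x ^ 2) := by
    refine ⟨d - (t ^ 2 + t * (u * x + v * y + w * z) + a * b * z ^ 2 + u * v * x * y +
      (u * w - b * v) * x * z + (v * w - a * u) * y * z), mul_left_cancel₀ hl.ne_zero ?_⟩
    linear_combination hd
  obtain ⟨hy, hx⟩ := hani _ _ ((hl.dvd_or_dvd h2).resolve_left fun h =>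
    hc' (by rw [sq]; exact mul_dvd_mul_left l h))
  exact ⟨dvd_mul_right _ _, hx, (dvd_neg.1 hy), dvd_mul_right _ _⟩

end

lemma padicInt_dvd_iff {l : ℕ} [Fact l.Prime] (x : ℤ_[l]) :
    (l : ℤ_[l]) ∣ x ↔ PadicInt.toZMod x = 0 := by
  rw [← RingHom.mem_ker, PadicInt.ker_toZMod, PadicInt.maximalIdeal_eq_span_p,
    Ideal.mem_span_singleton]

lemma padicInt_anisotropic {l : ℕ} [Fact l.Prime] {a b w : ℤ}
    (hani : ∀ m n : ℤ, (l : ℤ) ∣ a * m ^ 2 + w * m * n + b * n ^ 2 → (l : ℤ) ∣ m ∧ (l : ℤ) ∣ n)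
    (m n : ℤ_[l]) (h : (l : ℤ_[l]) ∣ a * m ^ 2 + w * m * n + b * n ^ 2) :
    (l : ℤ_[l]) ∣ m ∧ (l : ℤ_[l]) ∣ n := by
  simp only [padicInt_dvd_iff, map_add, map_mul, map_pow, map_intCast] at h ⊢
  obtain ⟨m', hm⟩ := ZMod.intCast_surjective (PadicInt.toZMod m)
  obtain ⟨n', hn⟩ := ZMod.intCast_surjective (PadicInt.toZMod n)
  rw [← hm, ← hn] at h ⊢
  rw [ZMod.intCast_zmod_eq_zero_iff_dvd, ZMod.intCast_zmod_eq_zero_iff_dvd]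
  apply hani
  rw [← ZMod.intCast_zmod_eq_zero_iff_dvd]
  exact_mod_cast h

lemma normForm_padic_eq_zero {l : ℕ} [Fact l.Prime] {a b c u v w : ℤ} (hc : (l : ℤ) ∣ c)
    (hu : (l : ℤ) ∣ u) (hv : (l : ℤ) ∣ v) (hc' : ¬ (l : ℤ) ^ 2 ∣ c)
    (hani : ∀ m n : ℤ, (l : ℤ) ∣ a * m ^ 2 + w * m * n + b * n ^ 2 → (l : ℤ) ∣ m ∧ (l : ℤ) ∣ n)
    {X : Fin 4 → ℚ_[l]}
    (h : normForm (a : ℚ_[l]) b c u v w (X 0) (X 1) (X 2) (X 3) = 0) : X = 0 := by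
  obtain ⟨i, hi⟩ := Finite.exists_max fun i => ‖X i‖
  by_contra hX
  have hXi : X i ≠ 0 := fun h0 => hX <| funext fun j => by
    have := hi j
    rw [h0, norm_zero] at this
    exact norm_le_zero_iff.1 this
  let Y : Fin 4 → ℤ_[l] := fun j => ⟨X j / X i, by
    rw [norm_div]; exact div_le_one_of_le₀ (hi j) (norm_nonneg _)⟩
  have hcast : ∀ {n k : ℤ}, n ∣ k → ((n : ℤ) : ℤ_[l]) ∣ k := fun h =>
    map_dvd (Int.castRingHom ℤ_[l]) h
  have hY : normForm (a : ℤ_[l]) b c u v w (Y 0) (Y 1) (Y 2) (Y 3) = 0 := by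
    have : normForm (a : ℚ_[l]) b c u v w (X 0 / X i) (X 1 / X i) (X 2 / X i) (X 3 / X i) =
        normForm (a : ℚ_[l]) b c u v w (X 0) (X 1) (X 2) (X 3) / X i ^ 2 := by
      simp only [normForm]; field_simp
    rw [h, zero_div] at this
    refine Subtype.ext (Eq.trans ?_ this)
    have hj : ∀ j, ((Y j : ℤ_[l]) : ℚ_[l]) = X j / X i := fun j => rfl
    simp only [normForm, ← hj]
    push_cast
    rfl
  have hdvd := dvd_of_sq_dvd_normForm (PadicInt.prime_p (p := l)) (by simpa using hcast hc)
    (by simpa using hcast hu) (by simpa using hcast hv)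
    (fun h => hc' (by
      have := (PadicInt.pow_p_dvd_int_iff 2 c).1 h
      exact_mod_cast this)) (padicInt_anisotropic hani) (hY ▸ dvd_zero _)
  have hall : ∀ j, (l : ℤ_[l]) ∣ Y j := by
    intro j
    fin_cases j
    exacts [hdvd.1, hdvd.2.1, hdvd.2.2.1, hdvd.2.2.2]
  have h1 : Y i = 1 := Subtype.ext (div_self hXi)
  exact (PadicInt.prime_p (p := l)).not_isUnit (isUnit_of_dvd_one (h1 ▸ hall i))

/-- Cramer's rule in dimension three. -/
lemma cramer_three {K : Type*} [Field K] {x₁ x₂ x₃ y₁ y₂ y₃ z₁ z₂ z₃ : K}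
    (hd : (x₂ * y₃ - x₃ * y₂) * z₁ + (x₃ * y₁ - x₁ * y₃) * z₂ + (x₁ * y₂ - x₂ * y₁) * z₃ ≠ 0)
    (v₁ v₂ v₃ : K) : ∃ p q r : K, v₁ = p * x₁ + q * y₁ + r * z₁ ∧
      v₂ = p * x₂ + q * y₂ + r * z₂ ∧ v₃ = p * x₃ + q * y₃ + r * z₃ := by
  set d := (x₂ * y₃ - x₃ * y₂) * z₁ + (x₃ * y₁ - x₁ * y₃) * z₂ + (x₁ * y₂ - x₂ * y₁) * z₃ with hdd
  refine ⟨(v₁ * (y₂ * z₃ - y₃ * z₂) + v₂ * (y₃ * z₁ - y₁ * z₃) + v₃ * (y₁ * z₂ - y₂ * z₁)) / d,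
    (v₁ * (z₂ * x₃ - z₃ * x₂) + v₂ * (z₃ * x₁ - z₁ * x₃) + v₃ * (z₁ * x₂ - z₂ * x₁)) / d,
    (v₁ * (x₂ * y₃ - x₃ * y₂) + v₂ * (x₃ * y₁ - x₁ * y₃) + v₃ * (x₁ * y₂ - x₂ * y₁)) / d,
    ?_, ?_, ?_⟩ <;>
  · rw [div_mul_eq_mul_div, div_mul_eq_mul_div, div_mul_eq_mul_div, ← add_div, ← add_div,
      eq_div_iff hd, hdd]
    ring

lemma CrossRel.normForm_eq {K : Type*} [Field K] [CharZero K] {a b c u v w : ℤ}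
    {x y z : ℍ[ℚ, c₁, c₂]} (h : CrossRel (a : ℚ) b c u v w x y z) (X : ℍ[K, (c₁ : K), (c₂ : K)]) :
    ∃ T : Fin 4 → K, normForm (a : K) b c u v w (T 0) (T 1) (T 2) (T 3) =
      X.re ^ 2 - c₁ * X.imI ^ 2 - c₂ * X.imJ ^ 2 + c₁ * c₂ * X.imK ^ 2 ∧ (T = 0 → X = 0) := by
  have hd : ((x.imJ * y.imK - x.imK * y.imJ) * z.imI + (x.imK * y.imI - x.imI * y.imK) * z.imJ
      + (x.imI * y.imJ - x.imJ * y.imI) * z.imK) ≠ 0 := fun e => h.ne (by rw [tri_eq, e, mul_zero])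
  have hd' : (((x.imJ * y.imK - x.imK * y.imJ) * z.imI + (x.imK * y.imI - x.imI * y.imK) * z.imJ
      + (x.imI * y.imJ - x.imJ * y.imI) * z.imK : ℚ) : K) ≠ 0 := by exact_mod_cast hd
  push_cast at hd'
  obtain ⟨p, q, r, e₁, e₂, e₃⟩ := cramer_three hd' X.imI X.imJ X.imK
  have hxx := congrArg (Rat.cast (K := K)) ((ip_eq x x).symm.trans h.ip_xx)
  have hyy := congrArg (Rat.cast (K := K)) ((ip_eq y y).symm.trans h.ip_yy)
  have hzz := congrArg (Rat.cast (K := K)) ((ip_eq z z).symm.trans h.ip_zz)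
  have hxy := congrArg (Rat.cast (K := K)) ((ip_eq x y).symm.trans h.ip_xy)
  have hxz := congrArg (Rat.cast (K := K)) ((ip_eq x z).symm.trans h.ip_xz)
  have hyz := congrArg (Rat.cast (K := K)) ((ip_eq y z).symm.trans h.ip_yz)
  rw [h.rex] at hxx hxy hxz
  rw [h.rey] at hyy hyz
  rw [h.rez] at hzz
  push_cast at hxx hyy hzz hxy hxz hyz
  refine ⟨![X.re - (u * p + v * q + w * r), 2 * p, 2 * q, 2 * r], ?_, fun hT => ?_⟩
  · simp only [Matrix.cons_val, normForm, e₁, e₂, e₃]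
    linear_combination -(p ^ 2 * hxx + q ^ 2 * hyy + r ^ 2 * hzz + 2 * p * q * hxy +
      2 * p * r * hxz + 2 * q * r * hyz)
  · have h0 := congrFun hT 0
    have h1 := congrFun hT 1
    have h2 := congrFun hT 2
    have h3 := congrFun hT 3
    simp at h0 h1 h2 h3
    ext
    · simpa [h1, h2, h3] using h0
    · simp [e₁, h1, h2, h3]
    · simp [e₂, h1, h2, h3]
    · simp [e₃, h1, h2, h3]

/-- A quaternion algebra with anisotropic norm form is a division ring. -/
lemma isDivision_of_anisotropic {K : Type*} [Field K] {d₁ d₂ : K}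
    (h : ∀ X : ℍ[K, d₁, d₂],
      X.re ^ 2 - d₁ * X.imI ^ 2 - d₂ * X.imJ ^ 2 + d₁ * d₂ * X.imK ^ 2 = 0 → X = 0)
    (X : ℍ[K, d₁, d₂]) (hX : X ≠ 0) : ∃ Y, X * Y = 1 ∧ Y * X = 1 := by
  have hN : X.re ^ 2 - d₁ * X.imI ^ 2 - d₂ * X.imJ ^ 2 + d₁ * d₂ * X.imK ^ 2 ≠ 0 :=
    fun e => hX (h X e)
  set N := X.re ^ 2 - d₁ * X.imI ^ 2 - d₂ * X.imJ ^ 2 + d₁ * d₂ * X.imK ^ 2 with hNdef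
  refine ⟨N⁻¹ • star X, ?_, ?_⟩
  · rw [mul_smul_comm, inv_smul_eq_iff₀ hN]
    ext <;> simp [hNdef] <;> ring
  · rw [smul_mul_assoc, inv_smul_eq_iff₀ hN]
    ext <;> simp [hNdef] <;> ring

/-- The half-discriminant of a maximal order is, up to sign, squarefree and only divisible by the
ramified prime. -/
lemma HasGood.eq_of_prime_dvd {p : ℕ} [Fact p.Prime] (hram : RamifiedExactlyAt p c₁ c₂)
    {O : Subalgebra ℤ ℍ[ℚ, c₁, c₂]} (hO : IsMaximalOrder O) {a b c u v w : ℤ}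
    (h : HasGood O a b c u v w) {l : ℕ} (hl : l.Prime) (hD : (l : ℤ) ∣ halfDisc a b c u v w) :
    l = p ∧ ¬ (l : ℤ) ^ 2 ∣ halfDisc a b c u v w := by
  have hlp := Nat.prime_iff_prime_int.1 hl
  obtain ⟨a', b', c', u', v', w', h', he, hc, hu, hv⟩ := h.exists_dvd hlp hD
  obtain ⟨hc', hani⟩ := h'.local_conditions hlp hO hc hu hv
  refine ⟨?_, he ▸ not_sq_dvd_halfDisc hlp hc hu hv hc' hani⟩
  by_contra hne
  have : Fact l.Prime := ⟨hl⟩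
  refine hram.2.2 l hne fun X hX => isDivision_of_anisotropic (fun X hX => ?_) X hX
  obtain ⟨x, y, z, hg⟩ := h'
  obtain ⟨T, hT, hT0⟩ := hg.toCrossRel.normForm_eq X
  exact hT0 (normForm_padic_eq_zero hc hu hv hc' hani (hT.trans hX))

lemma HasGood.abs_halfDisc_eq {p : ℕ} [Fact p.Prime] (hram : RamifiedExactlyAt p c₁ c₂)
    {O : Subalgebra ℤ ℍ[ℚ, c₁, c₂]} (hO : IsMaximalOrder O) {a b c u v w : ℤ}
    (h : HasGood O a b c u v w) (h1 : (halfDisc a b c u v w).natAbs ≠ 1) :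
    (halfDisc a b c u v w).natAbs = p := by
  obtain ⟨l, hl, k, hk⟩ := Nat.exists_prime_and_dvd h1
  obtain ⟨rfl, hsq⟩ := h.eq_of_prime_dvd hram hO hl (Int.natCast_dvd.2 ⟨k, hk⟩)
  by_cases hk1 : k = 1
  · rw [hk, hk1, mul_one]
  · obtain ⟨q, hq, m, rfl⟩ := Nat.exists_prime_and_dvd hk1
    obtain ⟨rfl, -⟩ := h.eq_of_prime_dvd hram hO hq
      (Int.natCast_dvd.2 ⟨l * m, by rw [hk]; ring⟩)
    exact absurd (by
      have : ((q ^ 2 : ℕ) : ℤ) ∣ halfDisc a b c u v w :=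
        Int.natCast_dvd.2 ⟨m, by rw [hk]; ring⟩
      exact_mod_cast this) hsq

lemma tri_comb_right (x y z : ℍ[ℚ, c₁, c₂]) (a b c : ℚ) :
    tri (a • x + b • y + c • z) y z = a * tri x y z := by
  simp [tri_eq, -mul_eq_mul_left_iff]; ring

lemma tri_comb_mid (x y z : ℍ[ℚ, c₁, c₂]) (a b c : ℚ) :
    tri x (a • x + b • y + c • z) z = b * tri x y z := by
  simp [tri_eq, -mul_eq_mul_left_iff]; ring

/-- The properties of the Gram matrix of a reduced basis of the Gross lattice of a maximal order
in the quaternion algebra ramified at `p` and infinity. -/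
structure ReducedForm (p A B C R S T : ℤ) : Prop where
  three_le : 3 ≤ A
  A_le_B : A ≤ B
  B_le_C : B ≤ C
  R_le : 2 * |R| ≤ A
  S_le : 2 * |S| ≤ A
  T_le : 2 * |T| ≤ B
  det_eq : det3 A B C R S T = 4 * p ^ 2
  mul_le : 3 * (A * B * C) ≤ 32 * p ^ 2
  R_dvd : 4 * p ∣ A * B - R ^ 2
  S_dvd : 4 * p ∣ A * C - S ^ 2
  T_dvd : 4 * p ∣ B * C - T ^ 2
  A_le : ∀ a b c : ℤ, ¬ (a = 0 ∧ b = 0 ∧ c = 0) → A ≤ q3 A B C R S T a b c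
  B_le : ∀ a b c : ℤ, ¬ (b = 0 ∧ c = 0) → B ≤ q3 A B C R S T a b c
  C_le : ∀ a b c : ℤ, c ≠ 0 → C ≤ q3 A B C R S T a b c

lemma MinBasis.exists_reducedForm {p : ℕ} [Fact p.Prime] (hram : RamifiedExactlyAt p c₁ c₂)
    (h₁ : c₁ < 0) (h₂ : c₂ < 0) {O : Subalgebra ℤ ℍ[ℚ, c₁, c₂]} (hO : IsMaximalOrder O)
    {x y z : ℍ[ℚ, c₁, c₂]} (h : MinBasis O x y z) :
    ∃ A B C R S T : ℤ, ReducedForm p A B C R S T ∧ ip x x = A ∧ ip y y = B ∧ ip z z = C ∧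
      ip x y = R ∧ ip x z = S ∧ ip y z = T := by
  obtain ⟨a, b, c, u, v, w, hg⟩ := h.exists_goodTriple h₁ h₂ hO.1
  have hA : ip x x = ((4 * b * c - u ^ 2 : ℤ) : ℚ) := by rw [hg.ip_xx]; push_cast; ring
  have hB : ip y y = ((4 * a * c - v ^ 2 : ℤ) : ℚ) := by rw [hg.ip_yy]; push_cast; ring
  have hC : ip z z = ((4 * a * b - w ^ 2 : ℤ) : ℚ) := by rw [hg.ip_zz]; push_cast; ring
  have hR : ip x y = ((u * v - 2 * c * w : ℤ) : ℚ) := by rw [hg.ip_xy]; push_cast; ring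
  have hS : ip x z = ((u * w - 2 * b * v : ℤ) : ℚ) := by rw [hg.ip_xz]; push_cast; ring
  have hT : ip y z = ((v * w - 2 * a * u : ℤ) : ℚ) := by rw [hg.ip_yz]; push_cast; ring
  have hdvdR : (4 * b * c - u ^ 2) * (4 * a * c - v ^ 2) - (u * v - 2 * c * w) ^ 2 =
      4 * halfDisc a b c u v w * c := by simp only [halfDisc]; ring
  have hdvdS : (4 * b * c - u ^ 2) * (4 * a * b - w ^ 2) - (u * w - 2 * b * v) ^ 2 =
      4 * halfDisc a b c u v w * b := by simp only [halfDisc]; ring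
  have hdvdT : (4 * a * c - v ^ 2) * (4 * a * b - w ^ 2) - (v * w - 2 * a * u) ^ 2 =
      4 * halfDisc a b c u v w * a := by simp only [halfDisc]; ring
  have hdet : det3 (4 * b * c - u ^ 2) (4 * a * c - v ^ 2) (4 * a * b - w ^ 2)
      (u * v - 2 * c * w) (u * w - 2 * b * v) (v * w - 2 * a * u) =
      4 * halfDisc a b c u v w ^ 2 := by simp only [halfDisc, det3]; ring
  generalize 4 * b * c - u ^ 2 = A at *
  generalize 4 * a * c - v ^ 2 = B at *
  generalize 4 * a * b - w ^ 2 = C at *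
  generalize u * v - 2 * c * w = R at *
  generalize u * w - 2 * b * v = S at *
  generalize v * w - 2 * a * u = T at *
  have hmul := h.mul_le_det h₁ h₂
  have hAB := h.A_le_B
  have hBC := h.B_le_C
  have hRl := h.R_le
  have hSl := h.S_le
  have hTl := h.T_le
  have hApos := h.A_pos h₁ h₂
  have hQ : ∀ a b c : ℤ, Nr ((a : ℚ) • x + (b : ℚ) • y + (c : ℚ) • z) =
      ((q3 A B C R S T a b c : ℤ) : ℚ) := fun a b c => by
    rw [Nr_comb, hA, hB, hC, hR, hS, hT]; simp only [q3]; push_cast; ring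
  rw [hA, hB, hC, hR, hS, hT] at hmul
  rw [hA, hB] at hAB
  rw [hB, hC] at hBC
  rw [hA, hR] at hRl
  rw [hA, hS] at hSl
  rw [hB, hT] at hTl
  rw [hA] at hApos
  replace hmul : 3 * (A * B * C) ≤ 8 * det3 A B C R S T := by
    simp only [det3] at hmul ⊢; exact_mod_cast hmul
  norm_cast at hAB hBC hRl hSl hTl hApos
  have hA3 : 3 ≤ A := by
    obtain ⟨n, hn, hn4⟩ := exists_Nr_of_mem_GrossLattice hO.1 h.memx
    rw [Nr_eq_ip, hA] at hn
    norm_cast at hn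
    omega
  have hABC : 27 ≤ A * B * C := by
    have : 3 * 3 ≤ A * B := mul_le_mul hA3 (by omega) (by norm_num) (by omega)
    have : 3 * 3 * 3 ≤ A * B * C := mul_le_mul this (by omega) (by norm_num) (by omega)
    omega
  have habs : (halfDisc a b c u v w).natAbs = p := by
    refine HasGood.abs_halfDisc_eq hram hO ⟨_, _, _, hg⟩ fun h1 => ?_
    have : halfDisc a b c u v w ^ 2 = 1 := by rw [← Int.natAbs_sq, h1]; rfl
    rw [this] at hdet
    omega
  have hsq : halfDisc a b c u v w ^ 2 = (p : ℤ) ^ 2 := by rw [← habs, Int.natAbs_sq]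
  rw [hsq] at hdet
  have hdvd (t : ℤ) : 4 * (p : ℤ) ∣ 4 * halfDisc a b c u v w * t := by
    refine Dvd.dvd.mul_right (mul_dvd_mul_left 4 ?_) t
    rw [← habs]; exact Int.natAbs_dvd.2 dvd_rfl
  refine ⟨A, B, C, R, S, T, ⟨hA3, hAB, hBC, ?_, ?_, ?_, hdet, by omega, hdvdR ▸ hdvd c,
    hdvdS ▸ hdvd b, hdvdT ▸ hdvd a,
    fun i j k hne => ?_, fun i j k hne => ?_, fun i j k hne => ?_⟩, hA, hB, hC, hR, hS, hT⟩
  · exact_mod_cast hRl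
  · exact_mod_cast hSl
  · exact_mod_cast hTl
  · have := h.xmin _ (h.comb_mem i j k) fun e => hne ?_
    · rw [Nr_eq_ip, hA, hQ] at this; exact_mod_cast this
    · have e1 := tri_comb_right x y z i j k
      have e2 := tri_comb_mid x y z i j k
      have e3 := tri_comb x y z i j k
      rw [e] at e1 e2 e3
      have h0 : tri 0 y z = 0 := by simp [tri_eq]
      have h0' : tri x 0 z = 0 := by simp [tri_eq]
      have h0'' : tri x y 0 = 0 := by simp [tri_eq]
      rw [h0, eq_comm, mul_eq_zero, or_iff_left h.zne] at e1
      rw [h0', eq_comm, mul_eq_zero, or_iff_left h.zne] at e2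
      rw [h0'', eq_comm, mul_eq_zero, or_iff_left h.zne] at e3
      exact_mod_cast And.intro e1 (And.intro e2 e3)
  · have := h.ymin _ (h.comb_mem i j k) fun e => hne ?_
    · rw [Nr_eq_ip, hB, hQ] at this; exact_mod_cast this
    · have e2 := tri_comb_mid x y z i j k
      have e3 := tri_comb x y z i j k
      have h0 : ip (0 : ℍ[ℚ, c₁, c₂]) z = 0 := by simp [ip_eq]
      have h0' : ip (0 : ℍ[ℚ, c₁, c₂]) y = 0 := by simp [ip_eq]
      rw [tri, e, h0, eq_comm, mul_eq_zero, or_iff_left h.zne] at e2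
      rw [tri_eq_neg_ip, e, h0', neg_zero, eq_comm, mul_eq_zero, or_iff_left h.zne] at e3
      exact_mod_cast And.intro e2 e3
  · have := h.zmin _ (h.comb_mem i j k) ?_
    · rw [Nr_eq_ip, hC, hQ] at this; exact_mod_cast this
    · rw [tri_comb]; exact mul_ne_zero (by exact_mod_cast hne) h.zne

lemma Equiv.mem_image_of_finite {X α : Type*} (e : X ≃ X) {M : Set α} (hM : M.Finite)
    {i j : α → X} (hi : Function.Injective i) (hj : Function.Injective j)
    (h : ∀ m ∈ M, e (j m) ∈ i '' M) {x : X} (hx : e x ∈ i '' M) : x ∈ j '' M := by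
  have hsub : (e ∘ j) '' M ⊆ i '' M := by
    rintro _ ⟨m, hm, rfl⟩; exact h m hm
  have heq := Set.eq_of_subset_of_ncard_le hsub (by
    rw [Set.ncard_image_of_injective _ hi, Set.ncard_image_of_injective _ (e.injective.comp hj)])
    (hM.image i)
  rw [← heq] at hx
  obtain ⟨m, hm, he⟩ := hx
  exact ⟨m, hm, e.injective he⟩

lemma sq_eq_sq_of_dvd {p : ℕ} (hp : p.Prime) {s t : ℤ} (hs : |s| < p) (ht : |t| < p)
    (h : 4 * (p : ℤ) ∣ s ^ 2 - t ^ 2) : s ^ 2 = t ^ 2 := by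
  rw [abs_lt] at hs ht
  rcases hp.eq_two_or_odd' with rfl | hodd
  · obtain ⟨hs1, hs2⟩ := hs
    obtain ⟨ht1, ht2⟩ := ht
    push_cast at hs1 hs2 ht1 ht2
    interval_cases s <;> interval_cases t <;> simp_all
  · have hodd' : IsCoprime (2 : ℤ) p := by
      rw [Int.isCoprime_iff_gcd_eq_one]
      exact_mod_cast (Nat.coprime_two_left.2 hodd)
    have h2 : (2 : ℤ) ∣ s - t := by
      have : Even (s ^ 2 - t ^ 2) := even_iff_two_dvd.2
        (Dvd.dvd.trans ⟨2 * p, by ring⟩ h)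
      rw [← even_iff_two_dvd]
      simpa [Int.even_sub, Int.even_pow] using this
    have h2' : (2 : ℤ) ∣ s + t := by omega
    have hpd : (p : ℤ) ∣ (s - t) * (s + t) := by
      rw [show (s - t) * (s + t) = s ^ 2 - t ^ 2 by ring]
      exact (dvd_mul_left _ _).trans h
    rcases (Nat.prime_iff_prime_int.1 hp).dvd_or_dvd hpd with h3 | h3
    · have h4 := hodd'.mul_dvd h2 h3
      have := Int.eq_zero_of_abs_lt_dvd h4 (by rw [abs_lt]; constructor <;> linarith)
      rw [sub_eq_zero.1 this]
    · have h4 := hodd'.mul_dvd h2' h3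
      have := Int.eq_zero_of_abs_lt_dvd h4 (by rw [abs_lt]; constructor <;> linarith)
      rw [eq_neg_of_add_eq_zero_left this, neg_sq]

namespace ReducedForm

variable {p A B C R S T A' B' C' R' S' T' : ℤ}

lemma le_q3 (h : ReducedForm p A B C R S T) (a b : ℤ) :
    a ^ 2 + b ^ 2 ≤ q3 A B C R S T a b 0 := by
  have h3 := h.three_le
  have hAB := h.A_le_B
  obtain ⟨h1, h2⟩ := abs_le.1 (show |2 * R| ≤ A by rw [abs_mul]; exact h.R_le)
  simp only [q3]
  nlinarith [mul_nonneg (sub_nonneg.2 h2) (sq_nonneg (a - b)),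
    mul_nonneg (neg_le_iff_add_nonneg.1 h1) (sq_nonneg (a + b)), sq_nonneg a, sq_nonneg b,
    mul_nonneg (sub_nonneg.2 hAB) (sq_nonneg b), mul_nonneg (sub_nonneg.2 h3) (sq_nonneg a),
    mul_nonneg (sub_nonneg.2 h3) (sq_nonneg b)]

lemma B_lt (h : ReducedForm p A B C R S T) (hp : 0 < p) : B < 2 * p := by
  have h3 := h.three_le
  have hAB := h.A_le_B
  have hBC := h.B_le_C
  have hm := h.mul_le
  have h1 : 3 * B * B ≤ A * B * C := by
    apply mul_le_mul (mul_le_mul_of_nonneg_right h3 (by linarith)) hBC (by linarith)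
    exact mul_nonneg (by linarith) (by linarith)
  nlinarith

lemma A_le_of_equiv (h' : ReducedForm p A' B' C' R' S' T')
    (e : ℤ × ℤ × ℤ ≃ ℤ × ℤ × ℤ)
    (he : ∀ v, q3 A' B' C' R' S' T' (e v).1 (e v).2.1 (e v).2.2 = q3 A B C R S T v.1 v.2.1 v.2.2) :
    A' ≤ A := by
  have h0 : e (0, 0, 0) = (0, 0, 0) := by
    by_contra hne
    have := h'.A_le (e (0, 0, 0)).1 (e (0, 0, 0)).2.1 (e (0, 0, 0)).2.2 fun hz =>
      hne (Prod.ext hz.1 (Prod.ext hz.2.1 hz.2.2))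
    rw [he] at this
    have h3 := h'.three_le
    simp [q3] at this
    omega
  have := h'.A_le (e (1, 0, 0)).1 (e (1, 0, 0)).2.1 (e (1, 0, 0)).2.2 fun hz => by
    have : e (1, 0, 0) = e (0, 0, 0) := by rw [h0]; exact Prod.ext hz.1 (Prod.ext hz.2.1 hz.2.2)
    simpa using e.injective this
  rw [he] at this
  simpa [q3] using this

lemma B_le_of_equiv (h : ReducedForm p A B C R S T) (h' : ReducedForm p A B' C' R' S' T')
    (e : ℤ × ℤ × ℤ ≃ ℤ × ℤ × ℤ)
    (he : ∀ v, q3 A B' C' R' S' T' (e v).1 (e v).2.1 (e v).2.2 = q3 A B C R S T v.1 v.2.1 v.2.2) :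
    B' ≤ B := by
  by_contra! hlt
  have hA := h.three_le
  have hM : {m : ℤ | A * m ^ 2 ≤ B}.Finite := by
    refine (Set.finite_Icc (-B) B).subset fun m hm => ?_
    have hm : A * m ^ 2 ≤ B := hm
    constructor <;> nlinarith [sq_nonneg m, sq_nonneg (m - 1), sq_nonneg (m + 1)]
  have key : ∀ v : ℤ × ℤ × ℤ, q3 A B C R S T v.1 v.2.1 v.2.2 ≤ B →
      e v ∈ (fun m : ℤ => ((m, 0, 0) : ℤ × ℤ × ℤ)) '' {m : ℤ | A * m ^ 2 ≤ B} := by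
    intro v hv
    rw [← he] at hv
    have hz : (e v).2.1 = 0 ∧ (e v).2.2 = 0 := by
      by_contra hz
      have := h'.B_le (e v).1 _ _ hz
      omega
    refine ⟨(e v).1, ?_, Prod.ext rfl (Prod.ext hz.1.symm hz.2.symm)⟩
    rw [hz.1, hz.2] at hv
    simpa [q3] using hv
  have hinj : Function.Injective (fun m : ℤ => ((m, 0, 0) : ℤ × ℤ × ℤ)) :=
    fun m n hmn => congrArg Prod.fst hmn
  obtain ⟨m, -, hm⟩ := e.mem_image_of_finite hM hinj hinj
    (fun m hm => key _ (by simpa [q3] using hm)) (key (0, 1, 0) (by simp [q3]))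
  simpa using congrArg (fun v => v.2.1) hm

lemma C_le_of_equiv (h : ReducedForm p A B C R S T) {ε : ℤ} (hε : ε ^ 2 = 1)
    (h' : ReducedForm p A B C' (ε * R) S' T') (e : ℤ × ℤ × ℤ ≃ ℤ × ℤ × ℤ)
    (he : ∀ v, q3 A B C' (ε * R) S' T' (e v).1 (e v).2.1 (e v).2.2 =
      q3 A B C R S T v.1 v.2.1 v.2.2) : C' ≤ C := by
  by_contra! hlt
  have hM : {m : ℤ × ℤ | q3 A B C R S T m.1 m.2 0 ≤ C}.Finite := by
    refine ((Set.finite_Icc (-C) C).prod (Set.finite_Icc (-C) C)).subset fun m hm => ?_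
    have hm : q3 A B C R S T m.1 m.2 0 ≤ C := hm
    have := h.le_q3 m.1 m.2
    refine ⟨⟨?_, ?_⟩, ?_, ?_⟩ <;> nlinarith [sq_nonneg m.1, sq_nonneg m.2,
      sq_nonneg (m.1 - 1), sq_nonneg (m.1 + 1), sq_nonneg (m.2 - 1), sq_nonneg (m.2 + 1)]
  have key : ∀ v : ℤ × ℤ × ℤ, q3 A B C R S T v.1 v.2.1 v.2.2 ≤ C →
      e v ∈ (fun m : ℤ × ℤ => ((m.1, ε * m.2, 0) : ℤ × ℤ × ℤ)) ''
        {m : ℤ × ℤ | q3 A B C R S T m.1 m.2 0 ≤ C} := by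
    intro v hv
    rw [← he] at hv
    have hz : (e v).2.2 = 0 := by
      by_contra hz
      have := h'.C_le (e v).1 (e v).2.1 _ hz
      omega
    refine ⟨((e v).1, ε * (e v).2.1), ?_, Prod.ext rfl (Prod.ext ?_ hz.symm)⟩
    · rw [hz] at hv
      refine le_trans (le_of_eq ?_) hv
      simp only [q3]
      linear_combination B * (e v).2.1 ^ 2 * hε
    · linear_combination (e v).2.1 * hε
  have hinj : Function.Injective (fun m : ℤ × ℤ => ((m.1, m.2, 0) : ℤ × ℤ × ℤ)) := by
    rintro ⟨m, n⟩ ⟨m', n'⟩ hmn; simpa using hmn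
  have hinj' : Function.Injective (fun m : ℤ × ℤ => ((m.1, ε * m.2, 0) : ℤ × ℤ × ℤ)) := by
    have : ε ≠ 0 := by rintro rfl; simp at hε
    rintro ⟨m, n⟩ ⟨m', n'⟩ hmn; simpa [this] using hmn
  obtain ⟨m, -, hm⟩ := e.mem_image_of_finite hM hinj' hinj
    (fun m hm => key _ hm) (key (0, 0, 1) (by simp [q3]))
  simpa using congrArg (fun v => v.2.2) hm

lemma exists_sign {s t : ℤ} (h : s ^ 2 = t ^ 2) : ∃ ε : ℤ, ε ^ 2 = 1 ∧ t = ε * s := by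
  rcases sq_eq_sq_iff_eq_or_eq_neg.1 h with rfl | rfl
  exacts [⟨1, by simp⟩, ⟨-1, by simp⟩]

/-- Two reduced forms representing the same numbers equally often agree up to signs. -/
lemma eq_up_to_sign {p : ℕ} (hp : p.Prime) (h : ReducedForm p A B C R S T)
    (h' : ReducedForm p A' B' C' R' S' T') (e : ℤ × ℤ × ℤ ≃ ℤ × ℤ × ℤ)
    (he : ∀ v, q3 A' B' C' R' S' T' (e v).1 (e v).2.1 (e v).2.2 =
      q3 A B C R S T v.1 v.2.1 v.2.2) :
    A' = A ∧ B' = B ∧ C' = C ∧ ∃ ε δ : ℤ, ε ^ 2 = 1 ∧ δ ^ 2 = 1 ∧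
      R' = ε * R ∧ S' = δ * S ∧ T' = ε * δ * T := by
  have he' : ∀ v, q3 A B C R S T (e.symm v).1 (e.symm v).2.1 (e.symm v).2.2 =
      q3 A' B' C' R' S' T' v.1 v.2.1 v.2.2 := fun v => by rw [← he, e.apply_symm_apply]
  have hp0 : (0 : ℤ) < p := by exact_mod_cast hp.pos
  obtain rfl := (h'.A_le_of_equiv e he).antisymm (h.A_le_of_equiv e.symm he')
  obtain rfl := (h.B_le_of_equiv h' e he).antisymm (h'.B_le_of_equiv h e.symm he')
  have hB := h.B_lt hp0
  have hAB := h.A_le_B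
  obtain ⟨ε, hε, rfl⟩ := exists_sign (sq_eq_sq_of_dvd hp (s := R) (t := R')
    (by linarith [h.R_le]) (by linarith [h'.R_le])
    (by simpa using dvd_sub h'.R_dvd h.R_dvd))
  have hεε : R = ε * (ε * R) := by linear_combination -R * hε
  obtain rfl := (h.C_le_of_equiv hε h' e he).antisymm
    (h'.C_le_of_equiv hε (hεε ▸ h) e.symm (by rw [← hεε]; exact he'))
  obtain ⟨δ, hδ, rfl⟩ := exists_sign (sq_eq_sq_of_dvd hp (s := S) (t := S')
    (by linarith [h.S_le]) (by linarith [h'.S_le])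
    (by simpa using dvd_sub h'.S_dvd h.S_dvd))
  obtain ⟨ζ, hζ, rfl⟩ := exists_sign (sq_eq_sq_of_dvd hp (s := T) (t := T')
    (by linarith [h.T_le]) (by linarith [h'.T_le])
    (by simpa using dvd_sub h'.T_dvd h.T_dvd))
  refine ⟨rfl, rfl, rfl, ?_⟩
  have hdet := h.det_eq.trans h'.det_eq.symm
  have hprod : (ε * δ * ζ - 1) * (R * S * T) = 0 := by
    have : 2 * ((ε * δ * ζ - 1) * (R * S * T)) = 0 := by
      simp only [det3] at hdet
      linear_combination -hdet + A' * T ^ 2 * hζ + B' * S ^ 2 * hδ + C' * R ^ 2 * hε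
    omega
  by_cases hR : R = 0
  · exact ⟨ζ * δ, δ, by rw [mul_pow, hζ, hδ, one_mul], hδ, by simp [hR], rfl,
      by linear_combination -ζ * T * hδ⟩
  by_cases hS : S = 0
  · exact ⟨ε, ζ * ε, hε, by rw [mul_pow, hζ, hε, one_mul], rfl, by simp [hS],
      by linear_combination -ζ * T * hε⟩
  refine ⟨ε, δ, hε, hδ, rfl, rfl, ?_⟩
  by_cases hT : T = 0
  · simp [hT]
  have h1 := (mul_eq_zero.1 hprod).resolve_right (by simp [hR, hS, hT])
  linear_combination -ζ * T * δ ^ 2 * hε - ζ * T * hδ + ε * δ * T * h1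

end ReducedForm

/-- Conjugation by a unit, up to sign. -/
def IsSignedConj (φ : ℍ[ℚ, c₁, c₂] → ℍ[ℚ, c₁, c₂]) : Prop :=
  ∃ (c d : ℍ[ℚ, c₁, c₂]) (s : ℚ), c * d = 1 ∧ d * c = 1 ∧ s ^ 2 = 1 ∧ ∀ v, φ v = s • (c * v * d)

namespace IsSignedConj

variable {φ ψ : ℍ[ℚ, c₁, c₂] → ℍ[ℚ, c₁, c₂]}

lemma comp (hφ : IsSignedConj φ) (hψ : IsSignedConj ψ) : IsSignedConj (φ ∘ ψ) := by
  obtain ⟨c, d, s, h1, h2, h3, h4⟩ := hφ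
  obtain ⟨c', d', s', h1', h2', h3', h4'⟩ := hψ
  refine ⟨c * c', d' * d, s * s', ?_, ?_, by rw [mul_pow, h3, h3', one_mul], fun v => ?_⟩
  · rw [mul_assoc, ← mul_assoc c', h1', one_mul, h1]
  · rw [mul_assoc, ← mul_assoc d, h2, one_mul, h2']
  · simp only [Function.comp, h4, h4', mul_smul_comm, smul_mul_assoc, smul_smul, mul_assoc]

lemma map_add (hφ : IsSignedConj φ) (v w : ℍ[ℚ, c₁, c₂]) : φ (v + w) = φ v + φ w := by
  obtain ⟨c, d, s, -, -, -, h⟩ := hφ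
  simp only [h, mul_add, add_mul, smul_add]

lemma map_smul (hφ : IsSignedConj φ) (q : ℚ) (v : ℍ[ℚ, c₁, c₂]) : φ (q • v) = q • φ v := by
  obtain ⟨c, d, s, -, -, -, h⟩ := hφ
  simp only [h, mul_smul_comm, smul_mul_assoc, smul_comm q]

lemma Nr_apply (hφ : IsSignedConj φ) (v : ℍ[ℚ, c₁, c₂]) : Nr (φ v) = Nr v := by
  obtain ⟨c, d, s, h1, -, hs, h⟩ := hφ
  have hcd : Nr c * Nr d = 1 := by rw [← Nr_mul, h1]; simp [Nr_eq]
  have hsm : ∀ w : ℍ[ℚ, c₁, c₂], Nr (s • w) = s ^ 2 * Nr w := fun w => by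
    simp [Nr_eq]; ring
  rw [h, hsm, hs, Nr_mul, Nr_mul]
  linear_combination Nr v * hcd

lemma ip_apply (hφ : IsSignedConj φ) (v w : ℍ[ℚ, c₁, c₂]) : ip (φ v) (φ w) = ip v w := by
  have hpol : ∀ v w : ℍ[ℚ, c₁, c₂], ip v w = (Nr (v + w) - Nr v - Nr w) / 2 := fun v w => by
    simp [Nr_eq, ip_eq]; ring
  rw [hpol, ← hφ.map_add, hφ.Nr_apply, hφ.Nr_apply, hφ.Nr_apply, hpol]

lemma re_apply (hφ : IsSignedConj φ) {v : ℍ[ℚ, c₁, c₂]} (hv : v.re = 0) : (φ v).re = 0 := by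
  obtain ⟨c, d, s, -, h1, -, h⟩ := hφ
  have hcomm : ∀ x y : ℍ[ℚ, c₁, c₂], (x * y).re = (y * x).re := fun x y => by simp; ring
  rw [h, QuaternionAlgebra.re_smul, mul_assoc, hcomm, mul_assoc, h1, mul_one, hv, smul_zero]

lemma injective (hφ : IsSignedConj φ) : Function.Injective φ := by
  obtain ⟨c, d, s, -, h1, hs, h⟩ := hφ
  refine Function.LeftInverse.injective (g := fun v => s • (d * v * c)) fun v => ?_
  simp only [h, mul_smul_comm, smul_mul_assoc, smul_smul, ← mul_assoc, h1, one_mul]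
  rw [mul_assoc, h1, mul_one, ← sq, hs, one_smul]

end IsSignedConj

lemma neg_conj_eq {v w : ℍ[ℚ, c₁, c₂]} (hv : v.re = 0) (hw : w.re = 0) :
    (-1 : ℚ) • (w * v * star w) = Nr w • v - (2 * ip v w) • w := by
  ext <;> simp [Nr_eq, ip_eq, hv, hw, -mul_eq_mul_left_iff] <;> ring

/-- The reflection exchanging two pure quaternions of the same norm. -/
lemma exists_reflection (h₁ : c₁ < 0) (h₂ : c₂ < 0) {u u' : ℍ[ℚ, c₁, c₂]} (hu : u.re = 0)
    (hu' : u'.re = 0) (h : ip u u = ip u' u') :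
    ∃ φ : ℍ[ℚ, c₁, c₂] → ℍ[ℚ, c₁, c₂], IsSignedConj φ ∧ φ u = u' ∧
      ∀ v : ℍ[ℚ, c₁, c₂], v.re = 0 → ip v u = ip v u' → φ v = v := by
  by_cases he : u = u'
  · exact ⟨id, ⟨1, 1, 1, by simp, by simp, by simp, by simp⟩, he, fun _ _ _ => rfl⟩
  have hN : Nr (u' - u) ≠ 0 := (Nr_pos h₁ h₂ (sub_ne_zero.2 (Ne.symm he))).ne'
  refine ⟨_, ⟨u' - u, (Nr (u' - u))⁻¹ • star (u' - u), -1, ?_, ?_, by norm_num, fun v => rfl⟩,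
    ?_, fun v hv hvu => ?_⟩
  · rw [mul_smul_comm, inv_smul_eq_iff₀ hN, mul_star_self']
    ext <;> simp
  · rw [smul_mul_assoc, inv_smul_eq_iff₀ hN, star_mul_self']
    ext <;> simp
  · have e : -(2 * ip u (u' - u)) = Nr (u' - u) := by
      rw [Nr_eq_ip]
      simp only [ip_sub_left, ip_sub_right]
      linear_combination h - ip_comm u u'
    rw [mul_smul_comm, smul_comm, inv_smul_eq_iff₀ hN, neg_conj_eq hu (by simp [hu, hu']),
      sub_eq_add_neg, ← neg_smul, e]
    module
  · rw [mul_smul_comm, smul_comm, inv_smul_eq_iff₀ hN, neg_conj_eq hv (by simp [hu, hu']),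
      ip_sub_right, hvu]
    simp

/-- Two independent triples of pure quaternions with the same Gram matrix are conjugate, up to
sign. -/
lemma exists_isSignedConj (h₁ : c₁ < 0) (h₂ : c₂ < 0) {x y z x' y' z' : ℍ[ℚ, c₁, c₂]}
    (hx : x.re = 0) (hy : y.re = 0) (hz : z.re = 0) (hx' : x'.re = 0) (hy' : y'.re = 0)
    (hz' : z'.re = 0) (hxx : ip x x = ip x' x') (hyy : ip y y = ip y' y')
    (hzz : ip z z = ip z' z') (hxy : ip x y = ip x' y') (hxz : ip x z = ip x' z')
    (hyz : ip y z = ip y' z') :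
    ∃ φ : ℍ[ℚ, c₁, c₂] → ℍ[ℚ, c₁, c₂], IsSignedConj φ ∧ φ x = x' ∧ φ y = y' ∧ φ z = z' := by
  obtain ⟨φ, hφ, hφx, -⟩ := exists_reflection h₁ h₂ hx hx' hxx
  obtain ⟨ψ, hψ, hψy, hψf⟩ := exists_reflection h₁ h₂ (hφ.re_apply hy) hy'
    ((hφ.ip_apply y y).trans hyy)
  have hψx : ψ x' = x' := hψf _ hx' (by
    rw [← hxy, ← hφ.ip_apply x y, hφx])
  have hψφ := hψ.comp hφ
  obtain ⟨χ, hχ, hχz, hχf⟩ := exists_reflection h₁ h₂ (hψφ.re_apply hz) hz'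
    ((hψφ.ip_apply z z).trans hzz)
  have ex : (ψ ∘ φ) x = x' := by simp [hφx, hψx]
  have ey : (ψ ∘ φ) y = y' := by simp [hψy]
  refine ⟨_, hχ.comp hψφ, ?_, ?_, hχz⟩
  · rw [Function.comp_apply, ex]
    exact hχf _ hx' (by rw [← hxz, ← hψφ.ip_apply x z, ex])
  · rw [Function.comp_apply, ey]
    exact hχf _ hy' (by rw [← hyz, ← hψφ.ip_apply y z, ey])

/-- Maximal orders whose Gross lattices have bases with the same Gram matrix are conjugate. -/
lemma exists_conj_of_gram_eq (h₁ : c₁ < 0) (h₂ : c₂ < 0) {O O' : Subalgebra ℤ ℍ[ℚ, c₁, c₂]}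
    (hO : IsOrder O) (hO' : IsOrder O') {x y z x' y' z' : ℍ[ℚ, c₁, c₂]}
    (hx : x.re = 0) (hy : y.re = 0) (hz : z.re = 0) (hx' : x'.re = 0) (hy' : y'.re = 0)
    (hz' : z'.re = 0) (hxx : ip x x = ip x' x') (hyy : ip y y = ip y' y')
    (hzz : ip z z = ip z' z') (hxy : ip x y = ip x' y') (hxz : ip x z = ip x' z')
    (hyz : ip y z = ip y' z')
    (hgen : ∀ v, v ∈ GrossLattice O ↔
      ∃ a b c : ℤ, v = (a : ℚ) • x + (b : ℚ) • y + (c : ℚ) • z)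
    (hgen' : ∀ v, v ∈ GrossLattice O' ↔
      ∃ a b c : ℤ, v = (a : ℚ) • x' + (b : ℚ) • y' + (c : ℚ) • z') :
    ∃ c d : ℍ[ℚ, c₁, c₂], c * d = 1 ∧ d * c = 1 ∧
      (O' : Set ℍ[ℚ, c₁, c₂]) = (fun x => c * x * d) '' (O : Set ℍ[ℚ, c₁, c₂]) := by
  obtain ⟨φ, hφ, ex, ey, ez⟩ := exists_isSignedConj h₁ h₂ hx hy hz hx' hy' hz' hxx hyy hzz hxy
    hxz hyz
  have hmap : ∀ v, v ∈ GrossLattice O ↔ φ v ∈ GrossLattice O' := fun v => by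
    rw [hgen, hgen']
    refine exists_congr fun a => exists_congr fun b => exists_congr fun c => ?_
    rw [← ex, ← ey, ← ez, ← hφ.map_smul, ← hφ.map_smul, ← hφ.map_smul, ← hφ.map_add,
      ← hφ.map_add, hφ.injective.eq_iff]
  obtain ⟨c, d, s, hcd, hdc, hs, h⟩ := hφ
  refine ⟨c, d, hcd, hdc, order_conj_of_GrossLattice_conj hO hO' hcd fun v => ?_⟩
  rw [hmap, h]
  rcases sq_eq_sq_iff_eq_or_eq_neg.1 (hs.trans (one_pow 2).symm) with rfl | rfl
  · rw [one_smul]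
  · rw [neg_one_smul, neg_mem_iff]

section Theta

open HurwitzZeta Filter Topology Real

open scoped ENNReal

/-- The error term in Poisson summation for one-dimensional Gaussians. -/
noncomputable def poissonError (s : ℝ) : ℝ := evenKernel 0 s - 1

lemma hasSum_poissonError {s : ℝ} (hs : 0 < s) :
    HasSum (fun n : ℤ => if n = 0 then 0 else rexp (-π * n ^ 2 * s)) (poissonError s) := by
  simpa [poissonError] using hasSum_int_evenKernel₀ 0 hs

lemma poissonError_nonneg {s : ℝ} (hs : 0 < s) : 0 ≤ poissonError s :=
  (hasSum_poissonError hs).nonneg fun n => by split_ifs <;> positivity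

lemma abs_cosKernel_sub_one_le (u : ℝ) {s : ℝ} (hs : 0 < s) :
    |cosKernel u s - 1| ≤ poissonError s := by
  have h1 := hasSum_int_cosKernel₀ u hs
  have h2 := tsum_of_norm_bounded (hasSum_poissonError hs)
    (f := fun n : ℤ => if n = 0 then (0 : ℂ) else
      Complex.exp (2 * π * Complex.I * u * n) * rexp (-π * n ^ 2 * s)) fun n => by
    split_ifs
    · simp
    · rw [norm_mul, Complex.norm_real, Real.norm_of_nonneg (exp_pos _).le,
        show 2 * (π : ℂ) * Complex.I * u * n = ((2 * π * u * n : ℝ) : ℂ) * Complex.I by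
          push_cast; ring, Complex.norm_exp_ofReal_mul_I, one_mul]
  rw [h1.tsum_eq] at h2
  rw [← Real.norm_eq_abs, ← Complex.norm_real]
  push_cast
  exact h2

lemma tendsto_rpow_mul_poissonError {α : ℝ} (hα : 0 < α) (r : ℝ) :
    Tendsto (fun s => s ^ r * poissonError (s / α)) atTop (𝓝 0) := by
  obtain ⟨p, hp, hO⟩ := isBigO_atTop_evenKernel_sub 0
  have h1 : poissonError =o[atTop] fun s : ℝ => s ^ (-r) := by
    simp only [if_true] at hO
    exact hO.trans_isLittleO (isLittleO_exp_neg_mul_rpow_atTop hp (-r))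
  have h2 := (h1.tendsto_div_nhds_zero.comp (tendsto_id.atTop_div_const hα)).const_mul (α ^ r)
  rw [mul_zero] at h2
  refine h2.congr' ?_
  filter_upwards [eventually_gt_atTop 0] with s hs
  simp only [Function.comp, id]
  rw [div_rpow hs.le hα.le, rpow_neg hs.le, rpow_neg hα.le]
  field_simp

/-- A one-dimensional Gaussian sum. -/
noncomputable def gaussSum1 (a u : ℝ) : ℝ≥0∞ :=
  ∑' n : ℤ, ENNReal.ofReal (rexp (-π * (n + u) ^ 2 * a))

lemma gaussSum1_eq {a : ℝ} (ha : 0 < a) (u : ℝ) :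
    gaussSum1 a u = ENNReal.ofReal (1 / a ^ (1 / 2 : ℝ) * cosKernel u (1 / a)) := by
  have h := hasSum_int_evenKernel u ha
  rw [gaussSum1, ← evenKernel_functional_equation, ← h.tsum_eq,
    ENNReal.ofReal_tsum_of_nonneg (fun n => (exp_pos _).le) h.summable]

lemma gaussSum1_le {a : ℝ} (ha : 0 < a) (u : ℝ) :
    gaussSum1 a u ≤ ENNReal.ofReal (1 / a ^ (1 / 2 : ℝ) * (1 + poissonError (1 / a))) := by
  rw [gaussSum1_eq ha]
  have := (abs_le.1 (abs_cosKernel_sub_one_le u (one_div_pos.2 ha))).2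
  gcongr
  linarith

lemma le_gaussSum1 {a : ℝ} (ha : 0 < a) (u : ℝ) :
    ENNReal.ofReal (1 / a ^ (1 / 2 : ℝ) * (1 - poissonError (1 / a))) ≤ gaussSum1 a u := by
  rw [gaussSum1_eq ha]
  have := (abs_le.1 (abs_cosKernel_sub_one_le u (one_div_pos.2 ha))).1
  gcongr
  linarith

/-- The theta series of a ternary quadratic form. -/
noncomputable def theta3 (A B C R S T t : ℝ) : ℝ≥0∞ :=
  ∑' v : ℤ × ℤ × ℤ, ENNReal.ofReal (rexp (-π * q3 A B C R S T v.1 v.2.1 v.2.2 * t))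

lemma theta3_eq {A B C R S T : ℝ} (hA : A ≠ 0) (hE : A * B - R ^ 2 ≠ 0) (t : ℝ) :
    theta3 A B C R S T t = ∑' z : ℤ,
      ENNReal.ofReal (rexp (-π * (z + 0) ^ 2 * (det3 A B C R S T / (A * B - R ^ 2) * t))) *
      ∑' y : ℤ, ENNReal.ofReal (rexp (-π * (y + (A * T - R * S) / (A * B - R ^ 2) * z) ^ 2 *
        ((A * B - R ^ 2) / A * t))) * gaussSum1 (A * t) (R / A * y + S / A * z) := by
  simp only [theta3, gaussSum1]
  rw [ENNReal.tsum_prod', ENNReal.tsum_comm, ENNReal.tsum_prod', ENNReal.tsum_comm]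
  simp only [← ENNReal.tsum_mul_left]
  refine tsum_congr fun z => tsum_congr fun y => tsum_congr fun x => ?_
  rw [← ENNReal.ofReal_mul (exp_pos _).le, ← ENNReal.ofReal_mul (exp_pos _).le, ← Real.exp_add,
    ← Real.exp_add, q3_eq_sum_squares hA hE]
  congr 2
  ring

lemma theta3_le {A B C R S T t : ℝ} (hA : 0 < A) (hE : 0 < A * B - R ^ 2)
    (hD : 0 < det3 A B C R S T) (ht : 0 < t) {f : ℝ → ℝ≥0∞}
    (hf : ∀ a > 0, ∀ u, gaussSum1 a u ≤ f a) :
    theta3 A B C R S T t ≤ f (det3 A B C R S T / (A * B - R ^ 2) * t) *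
      (f ((A * B - R ^ 2) / A * t) * f (A * t)) := by
  rw [theta3_eq hA.ne' hE.ne']
  calc
    _ ≤ ∑' z : ℤ, ENNReal.ofReal
        (rexp (-π * (z + 0) ^ 2 * (det3 A B C R S T / (A * B - R ^ 2) * t))) *
          (f ((A * B - R ^ 2) / A * t) * f (A * t)) :=
      ENNReal.tsum_le_tsum fun z => mul_le_mul_right ((ENNReal.tsum_le_tsum fun y =>
        mul_le_mul_right (hf _ (mul_pos hA ht) _) _).trans (ENNReal.tsum_mul_right.trans_le
          (mul_le_mul_left (hf _ (mul_pos (div_pos hE hA) ht) _) _))) _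
    _ ≤ _ := ENNReal.tsum_mul_right.trans_le
      (mul_le_mul_left (hf _ (mul_pos (div_pos hD hE) ht) 0) _)

lemma le_theta3 {A B C R S T t : ℝ} (hA : 0 < A) (hE : 0 < A * B - R ^ 2)
    (hD : 0 < det3 A B C R S T) (ht : 0 < t) {f : ℝ → ℝ≥0∞}
    (hf : ∀ a > 0, ∀ u, f a ≤ gaussSum1 a u) :
    f (det3 A B C R S T / (A * B - R ^ 2) * t) * (f ((A * B - R ^ 2) / A * t) * f (A * t)) ≤
      theta3 A B C R S T t := by
  rw [theta3_eq hA.ne' hE.ne']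
  calc
    _ ≤ ∑' z : ℤ, ENNReal.ofReal
        (rexp (-π * (z + 0) ^ 2 * (det3 A B C R S T / (A * B - R ^ 2) * t))) *
          (f ((A * B - R ^ 2) / A * t) * f (A * t)) :=
      (mul_le_mul_left (hf _ (mul_pos (div_pos hD hE) ht) 0) _).trans_eq
        ENNReal.tsum_mul_right.symm
    _ ≤ _ := ENNReal.tsum_le_tsum fun z => mul_le_mul_right
      (((mul_le_mul_left (hf _ (mul_pos (div_pos hE hA) ht) _) _).trans_eq
        ENNReal.tsum_mul_right.symm).trans (ENNReal.tsum_le_tsum fun y =>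
          mul_le_mul_right (hf _ (mul_pos hA ht) _) _)) _

/-- Asymptotics of the theta series of a ternary form. -/
lemma exists_theta3_bounds {A B C R S T : ℝ} (hA : 0 < A) (hE : 0 < A * B - R ^ 2)
    (hD : 0 < det3 A B C R S T) :
    ∃ δ : ℝ → ℝ, (∀ s > 0, 0 ≤ δ s) ∧ (∀ r : ℝ, Tendsto (fun s => s ^ r * δ s) atTop (𝓝 0)) ∧
      ∀ s > 0, δ s ≤ 1 →
        ENNReal.ofReal ((s ^ 3 / det3 A B C R S T) ^ (1 / 2 : ℝ) * (1 - δ s) ^ 3) ≤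
          theta3 A B C R S T (1 / s) ∧
        theta3 A B C R S T (1 / s) ≤
          ENNReal.ofReal ((s ^ 3 / det3 A B C R S T) ^ (1 / 2 : ℝ) * (1 + δ s) ^ 3) := by
  have hβ := div_pos hE hA
  have hγ := div_pos hD hE
  have hprod : A * ((A * B - R ^ 2) / A) * (det3 A B C R S T / (A * B - R ^ 2)) =
      det3 A B C R S T := by field_simp
  have hU := fun t ht => theta3_le hA hE hD (t := t) ht fun a ha u => gaussSum1_le ha u
  have hL := fun t ht => le_theta3 hA hE hD (t := t) ht fun a ha u => le_gaussSum1 ha u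
  generalize (A * B - R ^ 2) / A = β at *
  generalize det3 A B C R S T / (A * B - R ^ 2) = γ at *
  refine ⟨fun s => poissonError (s / A) + poissonError (s / β) + poissonError (s / γ),
    fun s hs => add_nonneg (add_nonneg (poissonError_nonneg (by positivity))
      (poissonError_nonneg (by positivity))) (poissonError_nonneg (by positivity)),
    fun r => ?_, fun s hs hδ => ?_⟩
  · simpa [mul_add] using ((tendsto_rpow_mul_poissonError hA r).add
      (tendsto_rpow_mul_poissonError hβ r)).add (tendsto_rpow_mul_poissonError hγ r)
  · have h1 := poissonError_nonneg (div_pos hs hA)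
    have h2 := poissonError_nonneg (div_pos hs hβ)
    have h3 := poissonError_nonneg (div_pos hs hγ)
    have hs' := one_div_pos.2 hs
    specialize hU _ hs'
    specialize hL _ hs'
    have e : ∀ a : ℝ, 1 / (a * (1 / s)) = s / a := fun a => by rw [mul_one_div, one_div_div]
    have e' : ∀ a : ℝ, 0 < a → 1 / (a * (1 / s)) ^ (1 / 2 : ℝ) = (s / a) ^ (1 / 2 : ℝ) :=
      fun a ha => by rw [← e, one_div (a * (1 / s)), inv_rpow (by positivity), one_div]
    simp only [e, e' _ hA, e' _ hβ, e' _ hγ] at hU hL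
    have hℓ : (s ^ 3 / det3 A B C R S T) ^ (1 / 2 : ℝ) =
        (s / γ) ^ (1 / 2 : ℝ) * ((s / β) ^ (1 / 2 : ℝ) * (s / A) ^ (1 / 2 : ℝ)) := by
      rw [← mul_rpow (by positivity) (by positivity), ← mul_rpow (by positivity) (by positivity),
        ← hprod]
      congr 1
      field_simp
    set pa := poissonError (s / A)
    set pb := poissonError (s / β)
    set pc := poissonError (s / γ)
    rw [hℓ]
    constructor
    · refine le_trans ?_ hL
      rw [← ENNReal.ofReal_mul, ← ENNReal.ofReal_mul]
      · apply ENNReal.ofReal_le_ofReal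
        rw [show (s / γ) ^ (1 / 2 : ℝ) * (1 - pc) * ((s / β) ^ (1 / 2 : ℝ) * (1 - pb) *
          ((s / A) ^ (1 / 2 : ℝ) * (1 - pa))) = (s / γ) ^ (1 / 2 : ℝ) * ((s / β) ^ (1 / 2 : ℝ) *
            (s / A) ^ (1 / 2 : ℝ)) * ((1 - pa) * (1 - pb) * (1 - pc)) by ring, pow_three']
        have hd : 0 ≤ 1 - (pa + pb + pc) := by linarith
        refine mul_le_mul_of_nonneg_left ?_ (by positivity)
        refine mul_le_mul (mul_le_mul ?_ ?_ hd ?_) ?_ hd (mul_nonneg ?_ ?_) <;> linarith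
      · exact mul_nonneg (by positivity) (by linarith)
      · exact mul_nonneg (by positivity) (by linarith)
    · refine hU.trans ?_
      rw [← ENNReal.ofReal_mul (by positivity), ← ENNReal.ofReal_mul (by positivity)]
      apply ENNReal.ofReal_le_ofReal
      rw [show (s / γ) ^ (1 / 2 : ℝ) * (1 + pc) * ((s / β) ^ (1 / 2 : ℝ) * (1 + pb) *
          ((s / A) ^ (1 / 2 : ℝ) * (1 + pa))) = (s / γ) ^ (1 / 2 : ℝ) * ((s / β) ^ (1 / 2 : ℝ) *
            (s / A) ^ (1 / 2 : ℝ)) * ((1 + pa) * (1 + pb) * (1 + pc)) by ring, pow_three']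
      refine mul_le_mul_of_nonneg_left ?_ (by positivity)
      refine mul_le_mul (mul_le_mul ?_ ?_ ?_ ?_) ?_ ?_ ?_ <;> first | linarith | positivity

/-- A norm-preserving injection between lattices of the same determinant is surjective. -/
lemma surjective_of_q3_eq {A B C R S T A' B' C' R' S' T' : ℝ} (hA : 0 < A)
    (hE : 0 < A * B - R ^ 2) (hD : 0 < det3 A B C R S T) (hA' : 0 < A')
    (hE' : 0 < A' * B' - R' ^ 2) (hdet : det3 A' B' C' R' S' T' = det3 A B C R S T)
    {f : ℤ × ℤ × ℤ → ℤ × ℤ × ℤ} (hf : Function.Injective f)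
    (h : ∀ v, q3 A' B' C' R' S' T' ((f v).1 : ℝ) (f v).2.1 (f v).2.2 =
      q3 A B C R S T (v.1 : ℝ) v.2.1 v.2.2) : Function.Surjective f := by
  by_contra hsurj
  simp only [Function.Surjective, not_forall, not_exists] at hsurj
  obtain ⟨w, hw⟩ := hsurj
  obtain ⟨δ, hδ0, hδ, hb⟩ := exists_theta3_bounds hA hE hD
  obtain ⟨δ', hδ0', hδ', hb'⟩ := exists_theta3_bounds hA' hE' (hdet ▸ hD)
  rw [hdet] at hb'
  have hθ : ∀ t : ℝ, theta3 A B C R S T t + ENNReal.ofReal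
      (rexp (-π * q3 A' B' C' R' S' T' (w.1 : ℝ) w.2.1 w.2.2 * t)) ≤
        theta3 A' B' C' R' S' T' t := fun t => by
    rw [add_comm, theta3.eq_def A', ENNReal.tsum_eq_add_tsum_ite w, theta3]
    refine add_le_add_right (le_trans (le_of_eq (tsum_congr fun v => ?_))
      (ENNReal.tsum_comp_le_tsum_of_injective hf _)) _
    rw [if_neg (hw v), h]
  generalize q3 A' B' C' R' S' T' (w.1 : ℝ) w.2.1 w.2.2 = q at hθ
  have hδz : Tendsto δ atTop (𝓝 0) := by simpa using hδ 0
  have hδz' : Tendsto δ' atTop (𝓝 0) := by simpa using hδ' 0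
  have hlim : Tendsto (fun s : ℝ => rexp (-π * q * (1 / s))) atTop (𝓝 1) := by
    have : Tendsto (fun s : ℝ => -π * q * (1 / s)) atTop (𝓝 (-π * q * 0)) :=
      (tendsto_const_nhds.div_atTop tendsto_id).const_mul _
    simpa [Function.comp_def] using (Real.continuous_exp.tendsto _).comp this
  have hlim' : Tendsto (fun s : ℝ => (1 / det3 A B C R S T) ^ (1 / 2 : ℝ) *
      (3 * (s ^ (3 / 2 : ℝ) * δ s) + 7 * (s ^ (3 / 2 : ℝ) * δ' s))) atTop (𝓝 0) := by
    simpa using (((hδ (3 / 2)).const_mul 3).add ((hδ' (3 / 2)).const_mul 7)).const_mul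
      ((1 / det3 A B C R S T) ^ (1 / 2 : ℝ))
  refine absurd (le_of_tendsto_of_tendsto hlim hlim' ?_) (by norm_num)
  filter_upwards [eventually_gt_atTop 0, hδz.eventually_le_const zero_lt_one,
    hδz'.eventually_le_const zero_lt_one] with s hs h1 h1'
  have h0 := hδ0 s hs
  have h0' := hδ0' s hs
  have key := (add_le_add_left (hb s hs h1).1 _).trans ((hθ (1 / s)).trans (hb' s hs h1').2)
  have hℓ : (s ^ 3 / det3 A B C R S T) ^ (1 / 2 : ℝ) =
      (1 / det3 A B C R S T) ^ (1 / 2 : ℝ) * s ^ (3 / 2 : ℝ) := by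
    rw [div_eq_mul_one_div, mul_rpow (by positivity) (by positivity), mul_comm, ← rpow_natCast,
      ← rpow_mul hs.le]
    norm_num
  have hd : (0 : ℝ) ≤ (1 - δ s) ^ 3 := pow_nonneg (by linarith) 3
  rw [← ENNReal.ofReal_add (mul_nonneg (by positivity) hd) (exp_pos _).le,
    ENNReal.ofReal_le_ofReal_iff (by positivity), hℓ] at key
  have hc : 0 ≤ (1 / det3 A B C R S T) ^ (1 / 2 : ℝ) * s ^ (3 / 2 : ℝ) := by positivity
  have hfin : (1 + δ' s) ^ 3 - (1 - δ s) ^ 3 ≤ 3 * δ s + 7 * δ' s := by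
    nlinarith [mul_nonneg h0' (sub_nonneg.2 h1'), mul_nonneg h0 (sub_nonneg.2 h1),
      mul_nonneg (mul_nonneg h0 h0) (sub_nonneg.2 h1),
      mul_nonneg (mul_nonneg h0' h0') (sub_nonneg.2 h1')]
  nlinarith [mul_le_mul_of_nonneg_left hfin hc]

end Theta

lemma finite_denomGroup_sq_le {N : ℕ} (hN : N ≠ 0) (M : ℚ) :
    {q : ℚ | q ∈ denomGroup N ∧ q ^ 2 ≤ M}.Finite := by
  obtain ⟨K, hK⟩ := exists_nat_ge ((N : ℚ) ^ 2 * M)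
  refine ((Set.finite_Icc (-(K : ℤ)) K).image fun m : ℤ => (m : ℚ) / N).subset ?_
  rintro q ⟨hq, hM⟩
  obtain ⟨m, hm⟩ := (mem_denomGroup hN).1 hq
  have hm2 : m ^ 2 ≤ (K : ℤ) := by
    have : (m : ℚ) ^ 2 ≤ K := by
      rw [← hm, mul_pow]
      exact (mul_le_mul_of_nonneg_left hM (sq_nonneg _)).trans hK
    exact_mod_cast this
  refine ⟨m, ?_, ?_⟩
  · constructor <;> nlinarith [sq_nonneg m, sq_nonneg (m - 1), sq_nonneg (m + 1)]
  · have hN' : (N : ℚ) ≠ 0 := by exact_mod_cast hN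
    simp only [← hm]
    field_simp

lemma finite_Nr_le (h₁ : c₁ < 0) (h₂ : c₂ < 0) {L : Submodule ℤ ℍ[ℚ, c₁, c₂]} (hL : L.FG)
    (M : ℚ) : {h | h ∈ L ∧ Nr h ≤ M}.Finite := by
  obtain ⟨N, hN, hd⟩ := exists_common_denom hL
  have hfin := fun K => finite_denomGroup_sq_le hN K
  refine (((hfin M).prod ((hfin (M / -c₁)).prod ((hfin (M / -c₂)).prod
    (hfin (M / (c₁ * c₂)))))).image fun q : ℚ × ℚ × ℚ × ℚ =>
      (⟨q.1, q.2.1, q.2.2.1, q.2.2.2⟩ : ℍ[ℚ, c₁, c₂])).subset ?_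
  rintro h ⟨hh, hM⟩
  obtain ⟨d0, d1, d2, d3⟩ := hd h hh
  have h12 := mul_pos_of_neg_of_neg h₁ h₂
  have e1 := mul_nonneg (neg_nonneg.2 h₁.le) (sq_nonneg h.imI)
  have e2 := mul_nonneg (neg_nonneg.2 h₂.le) (sq_nonneg h.imJ)
  have e3 := mul_nonneg h12.le (sq_nonneg h.imK)
  have e0 := sq_nonneg h.re
  rw [Nr_eq] at hM
  refine ⟨(h.re, h.imI, h.imJ, h.imK), ⟨⟨d0, ?_⟩, ⟨d1, ?_⟩, ⟨d2, ?_⟩, d3, ?_⟩, rfl⟩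
  · linarith
  · rw [le_div_iff₀ (neg_pos.2 h₁)]; linarith
  · rw [le_div_iff₀ (neg_pos.2 h₂)]; linarith
  · rw [le_div_iff₀ h12]; linarith

lemma Nr_zsmul (k : ℤ) (x : ℍ[ℚ, c₁, c₂]) : Nr (k • x) = k ^ 2 * Nr x := by
  rw [← Int.cast_smul_eq_zsmul ℚ, Nr_eq_ip, ip_smul_left, ip_smul_right, Nr_eq_ip]; ring

/-- Every nonzero lattice element is a positive multiple of a primitive one. -/
lemma exists_eq_smul_primitive (h₁ : c₁ < 0) (h₂ : c₂ < 0) {L : Submodule ℤ ℍ[ℚ, c₁, c₂]}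
    (hL : ∀ h ∈ L, ∃ n : ℕ, Nr h = n) {h : ℍ[ℚ, c₁, c₂]} (hh : h ∈ L) (h0 : h ≠ 0) :
    ∃ k : ℤ, 1 ≤ k ∧ ∃ u ∈ L, IsPrimitiveIn L u ∧ h = k • u := by
  obtain ⟨n, hn⟩ := hL h hh
  induction n using Nat.strong_induction_on generalizing h with
  | h n ih =>
    by_cases hp : IsPrimitiveIn L h
    · exact ⟨1, le_rfl, h, hh, hp, (one_smul _ _).symm⟩
    simp only [IsPrimitiveIn, not_forall, not_not] at hp
    obtain ⟨k, hk, u, hu, rfl⟩ := hp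
    have hu0 : u ≠ 0 := by rintro rfl; simp at h0
    obtain ⟨m, hm⟩ := hL u hu
    have hpos := Nr_pos h₁ h₂ hu0
    have hlt : m < n := by
      have hk' : (2 : ℚ) ≤ k := by exact_mod_cast hk
      rw [Nr_zsmul, hm] at hn
      rw [hm] at hpos
      have : (m : ℚ) < n := by rw [← hn]; nlinarith [mul_le_mul hk' hk' zero_le_two (by linarith)]
      exact_mod_cast this
    obtain ⟨l, hl, w, hw, hwp, rfl⟩ := ih m hlt hu hu0 hm
    exact ⟨k * l, by nlinarith, w, hw, hwp, smul_smul k l w⟩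

/-- A nonzero lattice element is a positive multiple of a primitive one in at most one way. -/
lemma IsPrimitiveIn.eq_of_smul_eq {L : Submodule ℤ ℍ[ℚ, c₁, c₂]} {u v : ℍ[ℚ, c₁, c₂]}
    (hu : u ∈ L) (hv : v ∈ L) (hup : IsPrimitiveIn L u) (hvp : IsPrimitiveIn L v) {k l : ℤ}
    (hk : 1 ≤ k) (hl : 1 ≤ l) (h : k • u = l • v) : k = l ∧ u = v := by
  obtain ⟨a, ha⟩ := Int.gcd_dvd_left k l
  obtain ⟨b, hb⟩ := Int.gcd_dvd_right k l
  have hg : (0 : ℤ) < Int.gcd k l := by exact_mod_cast Int.gcd_pos_of_ne_zero_left l (by omega)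
  set g : ℤ := (Int.gcd k l : ℤ)
  have hab : a • u = b • v := by
    rw [ha, hb, mul_smul, mul_smul] at h
    rw [← Int.cast_smul_eq_zsmul ℚ g, ← Int.cast_smul_eq_zsmul ℚ g] at h
    exact smul_right_injective _ (Int.cast_ne_zero.2 hg.ne') h
  obtain ⟨x, y, hxy⟩ : ∃ x y : ℤ, a * x + b * y = 1 := by
    refine ⟨Int.gcdA k l, Int.gcdB k l, mul_left_cancel₀ hg.ne' ?_⟩
    have := Int.gcd_eq_gcd_ab k l
    linear_combination -this - Int.gcdA k l * ha - Int.gcdB k l * hb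
  have ha0 : 0 < a := by nlinarith
  have hb0 : 0 < b := by nlinarith
  have hub : u = b • (x • v + y • u) := by
    rw [smul_add, smul_smul, smul_smul, mul_comm b x, mul_smul x, ← hab, smul_smul, ← add_smul,
      show x * a + b * y = 1 by linarith, one_smul]
  have hva : v = a • (x • v + y • u) := by
    rw [smul_add, smul_smul, smul_smul, mul_comm a y, mul_smul y, hab, smul_smul, ← add_smul,
      show a * x + y * b = 1 by linarith, one_smul]
  have hmem := add_mem (L.smul_mem x hv) (L.smul_mem y hu)
  have hb1 : b = 1 := by
    by_contra hne
    exact hup b (by omega) _ hmem hub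
  have ha1 : a = 1 := by
    by_contra hne
    exact hvp a (by omega) _ hmem hva
  subst ha1 hb1
  exact ⟨ha.trans hb.symm, by simpa using hab⟩

/-- If `L` has finitely many elements of each norm and at least as many primitive elements of each
positive norm in `L'` as in `L`, then there is a norm-preserving injection from `L` to `L'`. -/
lemma exists_injOn_of_primitive_card_le (h₁ : c₁ < 0) (h₂ : c₂ < 0)
    {L L' : Submodule ℤ ℍ[ℚ, c₁, c₂]} (hL : ∀ h ∈ L, ∃ n : ℕ, Nr h = n)
    (hfin : ∀ n : ℚ, {h | h ∈ L ∧ Nr h ≤ n}.Finite)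
    (hcard : ∀ n : ℕ, 1 ≤ n → Nat.card {h // h ∈ L ∧ Nr h = n ∧ IsPrimitiveIn L h} ≤
      Nat.card {h // h ∈ L' ∧ Nr h = n ∧ IsPrimitiveIn L' h}) :
    ∃ F : ℍ[ℚ, c₁, c₂] → ℍ[ℚ, c₁, c₂], Set.MapsTo F L L' ∧ Set.InjOn F L ∧
      ∀ h ∈ L, Nr (F h) = Nr h := by
  have hemb : ∀ n : ℕ, 1 ≤ n → ∃ f : ℍ[ℚ, c₁, c₂] → ℍ[ℚ, c₁, c₂],
      {h | h ∈ L ∧ Nr h = n ∧ IsPrimitiveIn L h} ⊆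
        f ⁻¹' {h | h ∈ L' ∧ Nr h = n ∧ IsPrimitiveIn L' h} ∧
      Set.InjOn f {h | h ∈ L ∧ Nr h = n ∧ IsPrimitiveIn L h} := fun n hn => by
    have hs : {h | h ∈ L ∧ Nr h = n ∧ IsPrimitiveIn L h}.Finite :=
      (hfin n).subset fun h hh => ⟨hh.1, hh.2.1.le⟩
    refine hs.exists_injOn_of_encard_le ?_
    by_cases ht : {h | h ∈ L' ∧ Nr h = n ∧ IsPrimitiveIn L' h}.Finite
    · rw [← hs.cast_ncard_eq, ← ht.cast_ncard_eq]
      exact_mod_cast hcard n hn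
    · rw [Set.Infinite.encard_eq ht]
      exact le_top
  choose! f hf hfi using hemb
  have hnorm : ∀ h ∈ L, h ≠ 0 → ∃ n : ℕ, 1 ≤ n ∧ Nr h = n := fun h hh h0 => by
    obtain ⟨n, hn⟩ := hL h hh
    have := Nr_pos h₁ h₂ h0
    rw [hn] at this
    exact ⟨n, by exact_mod_cast this, hn⟩
  choose! ν hν1 hν using hnorm
  choose! k hk u hu hup hku using fun h hh h0 => exists_eq_smul_primitive h₁ h₂ hL (h := h) hh h0
  have hu0 : ∀ h ∈ L, h ≠ 0 → u h ≠ 0 := fun h hh h0 e => h0 (by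
    rw [hku h hh h0, e, smul_zero])
  have hν1' := fun h hh h0 => hν1 (u h) (hu h hh h0) (hu0 h hh h0)
  have hmem : ∀ h (hh : h ∈ L) (h0 : h ≠ 0), u h ∈ {v | v ∈ L ∧ Nr v = ν (u h) ∧
      IsPrimitiveIn L v} := fun h hh h0 =>
    ⟨hu h hh h0, hν _ (hu h hh h0) (hu0 h hh h0), hup h hh h0⟩
  have hmem' : ∀ h (hh : h ∈ L) (h0 : h ≠ 0), f (ν (u h)) (u h) ∈ L' ∧
      Nr (f (ν (u h)) (u h)) = ν (u h) ∧ IsPrimitiveIn L' (f (ν (u h)) (u h)) :=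
    fun h hh h0 => hf _ (hν1' h hh h0) (hmem h hh h0)
  classical
  let F : ℍ[ℚ, c₁, c₂] → ℍ[ℚ, c₁, c₂] := fun h => if h = 0 then 0 else k h • f (ν (u h)) (u h)
  have hF0 : F 0 = 0 := if_pos rfl
  have hF : ∀ h, h ≠ 0 → F h = k h • f (ν (u h)) (u h) := fun h h0 => if_neg h0
  have hNF : ∀ h ∈ L, Nr (F h) = Nr h := fun h hh => by
    by_cases h0 : h = 0
    · rw [h0, hF0]
    · conv_rhs => rw [hku h hh h0]
      rw [hF h h0, Nr_zsmul, Nr_zsmul, (hmem' h hh h0).2.1, (hmem h hh h0).2.1]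
  refine ⟨F, fun h hh => ?_, fun h hh h' hh' he => ?_, hNF⟩
  · by_cases h0 : h = 0
    · rw [h0, hF0]; exact zero_mem L'
    · rw [hF h h0]; exact L'.smul_mem _ (hmem' h hh h0).1
  · have hN : Nr h = Nr h' := by rw [← hNF h hh, he, hNF h' hh']
    by_cases h0 : h = 0
    · rw [h0, eq_comm, ← Nr_eq_zero h₁ h₂, ← hN, h0, Nr_eq_zero h₁ h₂]
    have h0' : h' ≠ 0 := by rwa [Ne, ← Nr_eq_zero h₁ h₂, ← hN, Nr_eq_zero h₁ h₂]
    rw [hF h h0, hF h' h0'] at he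
    obtain ⟨ek, ef⟩ := IsPrimitiveIn.eq_of_smul_eq (hmem' h hh h0).1 (hmem' h' hh' h0').1
      (hmem' h hh h0).2.2 (hmem' h' hh' h0').2.2 (hk h hh h0) (hk h' hh' h0') he
    have hn : ν (u h) = ν (u h') := by
      have := congrArg Nr ef
      rw [(hmem' h hh h0).2.1, (hmem' h' hh' h0').2.1] at this
      exact_mod_cast this
    rw [hku h hh h0, hku h' hh' h0', ek]
    congr 1
    rw [← hn] at ef
    exact hfi _ (hν1' h hh h0) (hmem h hh h0) (hn ▸ hmem h' hh' h0') ef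

lemma MinBasis.comb_injective {O : Subalgebra ℤ ℍ[ℚ, c₁, c₂]} {x y z : ℍ[ℚ, c₁, c₂]}
    (h : MinBasis O x y z) : Function.Injective fun v : ℤ × ℤ × ℤ =>
      (v.1 : ℚ) • x + (v.2.1 : ℚ) • y + (v.2.2 : ℚ) • z := by
  rintro ⟨a, b, c⟩ ⟨a', b', c'⟩ e
  simp only at e
  have e1 := tri_comb_right x y z a b c
  have e2 := tri_comb_mid x y z a b c
  have e3 := tri_comb x y z a b c
  rw [e, tri_comb_right, mul_left_inj' h.zne, Int.cast_inj] at e1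
  rw [e, tri_comb_mid, mul_left_inj' h.zne, Int.cast_inj] at e2
  rw [e, tri_comb, mul_left_inj' h.zne, Int.cast_inj] at e3
  rw [e1, e2, e3]

lemma MinBasis.mem_iff (h₁ : c₁ < 0) (h₂ : c₂ < 0) {O : Subalgebra ℤ ℍ[ℚ, c₁, c₂]}
    {x y z : ℍ[ℚ, c₁, c₂]} (h : MinBasis O x y z) (v : ℍ[ℚ, c₁, c₂]) : v ∈ GrossLattice O ↔
      ∃ a b c : ℤ, v = (a : ℚ) • x + (b : ℚ) • y + (c : ℚ) • z :=
  ⟨h.gen h₁ h₂, by rintro ⟨a, b, c, rfl⟩; exact h.comb_mem a b c⟩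

lemma ReducedForm.pos {p A B C R S T : ℤ} (h : ReducedForm p A B C R S T) (hp : p ≠ 0) :
    0 < (A : ℝ) ∧ 0 < (A * B - R ^ 2 : ℝ) ∧ 0 < det3 (A : ℝ) B C R S T := by
  have h3 := h.three_le
  have hAB := h.A_le_B
  obtain ⟨h1, h2⟩ := abs_le.1 (show |2 * R| ≤ A by rw [abs_mul]; exact h.R_le)
  have hdet : det3 (A : ℝ) B C R S T = ((4 * p ^ 2 : ℤ) : ℝ) := by
    rw [← h.det_eq]; simp [det3]
  refine ⟨by exact_mod_cast (by linarith : 0 < A), ?_, ?_⟩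
  · have : 0 < A * B - R ^ 2 := by nlinarith
    exact_mod_cast this
  · rw [hdet]
    exact_mod_cast (by positivity : 0 < 4 * p ^ 2)

lemma ReducedForm.bijective_of_injective {p A B C R S T A' B' C' R' S' T' : ℤ} (hp : p ≠ 0)
    (h : ReducedForm p A B C R S T) (h' : ReducedForm p A' B' C' R' S' T')
    {f : ℤ × ℤ × ℤ → ℤ × ℤ × ℤ} (hf : Function.Injective f)
    (he : ∀ v, q3 A' B' C' R' S' T' (f v).1 (f v).2.1 (f v).2.2 =
      q3 A B C R S T v.1 v.2.1 v.2.2) :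
    Function.Bijective f := by
  obtain ⟨hA, hE, hD⟩ := h.pos hp
  obtain ⟨hA', hE', -⟩ := h'.pos hp
  refine ⟨hf, surjective_of_q3_eq (C' := C') (S' := S') (T' := T') hA hE hD hA' hE' ?_ hf
    fun v => ?_⟩
  · have := h'.det_eq.trans h.det_eq.symm
    simp only [det3] at this ⊢
    exact_mod_cast this
  · have := he v
    simp only [q3] at this ⊢
    exact_mod_cast this

/-- Chevyrev–Galbraith conjecture: if `O'^T` optimally dominates `O^T`,
then `O` and `O'` are of the same type, i.e. conjugate by a nonzero element of `B`. -/
theorem same_type_of_optimally_dominates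
    (p : ℕ) [Fact p.Prime] (c₁ c₂ : ℚ) (hc₁ : c₁ ≠ 0) (hc₂ : c₂ ≠ 0)
    (hram : RamifiedExactlyAt p c₁ c₂)
    (O O' : Subalgebra ℤ ℍ[ℚ, c₁, c₂])
    (hO : IsMaximalOrder O) (hO' : IsMaximalOrder O')
    (hdom : ∀ n : ℕ, 1 ≤ n → aCount O n ≤ aCount O' n) :
    ∃ c d : ℍ[ℚ, c₁, c₂], c * d = 1 ∧ d * c = 1 ∧
      (O' : Set ℍ[ℚ, c₁, c₂]) = (fun x => c * x * d) '' (O : Set ℍ[ℚ, c₁, c₂]) := by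
  have hp : p.Prime := Fact.out
  obtain ⟨h₁, h₂⟩ := neg_of_division hram.1
  have hnat : ∀ h ∈ GrossLattice O, ∃ n : ℕ, Nr h = n := fun h hh => by
    obtain ⟨n, hn, -⟩ := exists_Nr_of_mem_GrossLattice hO.1 hh
    have := Nr_nonneg h₁ h₂ h
    rw [hn] at this
    lift n to ℕ using by exact_mod_cast this
    exact ⟨n, by simpa using hn⟩
  obtain ⟨F, hF, hFi, hFN⟩ := exists_injOn_of_primitive_card_le h₁ h₂ hnat
    (fun n => finite_Nr_le h₁ h₂ (hO.1.1.map _) n) hdom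
  obtain ⟨x, y, z, hB⟩ := exists_minBasis h₁ h₂ hO.1
  obtain ⟨x', y', z', hB'⟩ := exists_minBasis h₁ h₂ hO'.1
  obtain ⟨A, B, C, R, S, T, hQ, eA, eB, eC, eR, eS, eT⟩ := hB.exists_reducedForm hram h₁ h₂ hO
  obtain ⟨A', B', C', R', S', T', hQ', eA', eB', eC', eR', eS', eT'⟩ :=
    hB'.exists_reducedForm hram h₁ h₂ hO'
  have hex : ∀ v : ℤ × ℤ × ℤ, ∃ w : ℤ × ℤ × ℤ,
      F ((v.1 : ℚ) • x + (v.2.1 : ℚ) • y + (v.2.2 : ℚ) • z) =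
        (w.1 : ℚ) • x' + (w.2.1 : ℚ) • y' + (w.2.2 : ℚ) • z' := fun v => by
    obtain ⟨a, b, c, e⟩ := hB'.gen h₁ h₂ (hF (hB.comb_mem v.1 v.2.1 v.2.2))
    exact ⟨(a, b, c), e⟩
  choose f hf using hex
  have hfi : Function.Injective f := fun v w e => hB.comb_injective
    (hFi (hB.comb_mem _ _ _) (hB.comb_mem _ _ _) (by rw [hf, hf, e]))
  have hfq : ∀ v, q3 A' B' C' R' S' T' (f v).1 (f v).2.1 (f v).2.2 =
      q3 A B C R S T v.1 v.2.1 v.2.2 := fun v => by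
    have := hFN _ (hB.comb_mem v.1 v.2.1 v.2.2)
    rw [hf, Nr_comb, Nr_comb, eA, eB, eC, eR, eS, eT, eA', eB', eC', eR', eS', eT'] at this
    simp only [q3] at this ⊢
    exact_mod_cast this
  obtain ⟨rfl, rfl, rfl, ε, δ, hε, hδ, rfl, rfl, rfl⟩ := hQ.eq_up_to_sign hp hQ'
    (Equiv.ofBijective f (hQ.bijective_of_injective (by exact_mod_cast hp.ne_zero) hQ' hfi hfq)) hfq
  have hεq : (ε : ℚ) ^ 2 = 1 := by exact_mod_cast hε
  have hδq : (δ : ℚ) ^ 2 = 1 := by exact_mod_cast hδ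
  push_cast at eR' eS' eT'
  refine exists_conj_of_gram_eq h₁ h₂ hO.1 hO'.1 hB.rex hB.rey hB.rez hB'.rex
    (y' := (ε : ℚ) • y') (z' := (δ : ℚ) • z') (by simp [hB'.rey]) (by simp [hB'.rez])
    (by rw [eA, eA']) ?_ ?_ ?_ ?_ ?_ (hB.mem_iff h₁ h₂) fun v => ?_
  · rw [ip_smul_left, ip_smul_right, eB, eB']
    linear_combination -(B' : ℚ) * hεq
  · rw [ip_smul_left, ip_smul_right, eC, eC']
    linear_combination -(C' : ℚ) * hδq
  · rw [ip_smul_right, eR, eR']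
    linear_combination -(R : ℚ) * hεq
  · rw [ip_smul_right, eS, eS']
    linear_combination -(S : ℚ) * hδq
  · rw [ip_smul_left, ip_smul_right, eT, eT']
    linear_combination -(T : ℚ) * δ ^ 2 * hεq - (T : ℚ) * hδq
  · rw [hB'.mem_iff h₁ h₂]
    constructor
    · rintro ⟨a, b, c, rfl⟩
      refine ⟨a, b * ε, c * δ, ?_⟩
      push_cast
      rw [smul_smul, smul_smul, mul_assoc, mul_assoc, ← sq, ← sq, hεq, hδq, mul_one, mul_one]
    · rintro ⟨a, b, c, rfl⟩
      exact ⟨a, b * ε, c * δ, by push_cast; rw [smul_smul, smul_smul]⟩
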